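/- arXiv:math/0410406 — 3 statements merged into one kernel-verified Lean document; each statement's English description precedes it below -/
import Mathlib

section
/- Let X be an infinite set of regular cardinality κ. A submonoid M of the full transformation monoid O^(1) with S ⊆ M is precomplete if and only if M equals the monoid A, or M equals G_ξ or M_ξ for ξ = 1 or for some infinite cardinal ξ with ℵ₀ ≤ ξ ≤ κ. -/
open Cardinal

universe u

/-- The submonoid of all permutations inside the full transformation monoid `Function.End X`. -/
def permSubmonoid (X : Type u) : Submonoid (Function.End X) where
  carrier := {f | Function.Bijective f}
  mul_mem' hf hg := hf.comp hg
  one_mem' := Function.bijective_id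

/-- A submonoid `C ≠ O⁽¹⁾` is precomplete iff together with any function outside of it,
it generates the full transformation monoid. -/
def Precomplete {X : Type u} (C : Submonoid (Function.End X)) : Prop :=
  C ≠ ⊤ ∧ ∀ f : Function.End X, f ∉ C →
    Submonoid.closure ((C : Set (Function.End X)) ∪ {f}) = ⊤

/-- `f` is `ξ`-injective: `f` is injective off a set of cardinality `< ξ`. -/
def XiInjective {X : Type u} (ξ : Cardinal.{u}) (f : Function.End X) : Prop :=
  ∃ Y : Set X, #Y < ξ ∧ Set.InjOn f Yᶜ

/-- `f` is `ξ`-surjective: the complement of its range has cardinality `< ξ`. -/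
def XiSurjective {X : Type u} (ξ : Cardinal.{u}) (f : Function.End X) : Prop :=
  #((Set.range f)ᶜ : Set X) < ξ

/-- The set `A` of functions almost all of whose fibers are small. -/
def monA (X : Type u) : Set (Function.End X) :=
  {f | #{y : X | ¬ #(f ⁻¹' {y}) < #X} < #X}

/-- The set `A'` of functions `f` such that for some `ξ < |X|`, almost all fibers of `f`
have cardinality at most `ξ`. -/
def monA' (X : Type u) : Set (Function.End X) :=
  {f | ∃ ξ : Cardinal.{u}, ξ < #X ∧ #{x : X | ¬ #(f ⁻¹' {x}) ≤ ξ} < #X}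

/-- The set `G_ξ` of functions which are `ξ`-injective or not `ξ`-surjective. -/
def monG (X : Type u) (ξ : Cardinal.{u}) : Set (Function.End X) :=
  {f | XiInjective ξ f ∨ ¬ XiSurjective ξ f}

/-- The set `M_ξ` of functions which are `ξ`-surjective or not `ξ`-injective. -/
def monM (X : Type u) (ξ : Cardinal.{u}) : Set (Function.End X) :=
  {f | XiSurjective ξ f ∨ ¬ XiInjective ξ f}

/-- The kernel sequence of `f` assigns to every cardinal `ξ` the number of
(nonempty) fibers of `f` of cardinality `ξ`. -/
noncomputable def kernelSeq {X : Type u} (f : X → X) (ξ : Cardinal.{u}) : Cardinal.{u} :=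
  #{A : Set X // (∃ y : X, A = f ⁻¹' {y}) ∧ A.Nonempty ∧ #A = ξ}

/-- The set `R`: the range of the sequence `(n i)` together with all infinite
successor cardinals `≤ κ`. -/
def setR (κ : Cardinal.{u}) (n : ℕ → ℕ) : Set Cardinal.{u} :=
  (Set.range fun i : ℕ => (n i : Cardinal.{u})) ∪
    {ξ | ℵ₀ ≤ ξ ∧ ξ ≤ κ ∧ ∃ μ : Cardinal.{u}, ξ = Order.succ μ}

/-- The sum of a set of cardinals. -/
noncomputable def setSum (A : Set Cardinal.{u}) : Cardinal.{u + 1} :=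
  Cardinal.sum fun η : A => (η : Cardinal.{u})

section Admissible

open Function Set

variable {X : Type u}

/-- The cardinals `1` and `ℵ₀ ≤ ξ ≤ κ` indexing the monoids `G_ξ` and `M_ξ`. -/
def AdmissibleIndex (κ ξ : Cardinal.{u}) : Prop := ξ = 1 ∨ (ℵ₀ ≤ ξ ∧ ξ ≤ κ)

theorem AdmissibleIndex.pos {κ ξ : Cardinal.{u}} (h : AdmissibleIndex κ ξ) : 0 < ξ := by
  rcases h with rfl | ⟨h, -⟩
  · exact zero_lt_one
  · exact aleph0_pos.trans_le h

theorem AdmissibleIndex.le {κ ξ : Cardinal.{u}} (hκ : ℵ₀ ≤ κ) (h : AdmissibleIndex κ ξ) :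
    ξ ≤ κ := by
  rcases h with rfl | ⟨-, h⟩
  · exact one_le_aleph0.trans hκ
  · exact h

theorem AdmissibleIndex.add_lt {κ ξ a b : Cardinal.{u}} (h : AdmissibleIndex κ ξ)
    (ha : a < ξ) (hb : b < ξ) : a + b < ξ := by
  rcases h with rfl | ⟨h, -⟩
  · rw [Cardinal.lt_one_iff] at *
    simp [ha, hb]
  · exact Cardinal.add_lt_of_lt h ha hb

theorem AdmissibleIndex.mk_union_lt {κ ξ : Cardinal.{u}} (h : AdmissibleIndex κ ξ)
    {s t : Set X} (hs : #s < ξ) (ht : #t < ξ) : #(s ∪ t : Set X) < ξ :=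
  (mk_union_le s t).trans_lt (h.add_lt hs ht)

theorem mem_monA_iff {f : X → X} :
    f ∈ monA X ↔ #{y : X | ¬ #(f ⁻¹' {y} : Set X) < #X} < #X := Iff.rfl

theorem mem_monA_of_forall [Nonempty X] {f : X → X} (h : ∀ y, #(f ⁻¹' {y} : Set X) < #X) :
    f ∈ monA X := by
  have : {y : X | ¬ #(f ⁻¹' {y} : Set X) < #X} = ∅ :=
    eq_empty_of_forall_notMem fun y hy => hy (h y)
  rw [mem_monA_iff, this, mk_eq_zero]
  exact (mk_ne_zero X).pos

theorem notMem_monG_iff {ξ : Cardinal.{u}} {f : X → X} :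
    f ∉ monG X ξ ↔ ¬ XiInjective ξ f ∧ XiSurjective ξ f :=
  not_or.trans (and_congr_right fun _ => not_not)

theorem notMem_monM_iff {ξ : Cardinal.{u}} {f : X → X} :
    f ∉ monM X ξ ↔ ¬ XiSurjective ξ f ∧ XiInjective ξ f :=
  not_or.trans (and_congr_right fun _ => not_not)

theorem xiSurjective_iff {ξ : Cardinal.{u}} {f : X → X} :
    XiSurjective ξ f ↔ #((range f)ᶜ : Set X) < ξ := Iff.rfl

theorem XiInjective.of_comp {ξ : Cardinal.{u}} {f g : X → X}
    (h : XiInjective ξ (g ∘ f)) : XiInjective ξ f := by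
  obtain ⟨Y, hY, hinj⟩ := h
  exact ⟨Y, hY, fun x hx y hy hxy => hinj hx hy (congrArg g hxy)⟩

theorem XiSurjective.of_comp {ξ : Cardinal.{u}} {f g : X → X}
    (h : XiSurjective ξ (g ∘ f)) : XiSurjective ξ g :=
  (mk_le_mk_of_subset (compl_subset_compl.2 (range_comp_subset_range f g))).trans_lt h

theorem XiInjective.comp {κ ξ : Cardinal.{u}} (hξ : AdmissibleIndex κ ξ) {f g : X → X}
    (hg : XiInjective ξ g) (hf : XiInjective ξ f) : XiInjective ξ (g ∘ f) := by
  obtain ⟨Y, hY, hYi⟩ := hf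
  obtain ⟨Z, hZ, hZi⟩ := hg
  refine ⟨Y ∪ (Yᶜ ∩ f ⁻¹' Z), hξ.mk_union_lt hY (lt_of_le_of_lt ?_ hZ), ?_⟩
  · have hi : InjOn f (Yᶜ ∩ f ⁻¹' Z) := hYi.mono inter_subset_left
    rw [← mk_image_eq_of_injOn _ _ hi]
    exact mk_le_mk_of_subset (by rintro _ ⟨x, hx, rfl⟩; exact hx.2)
  · intro x hx y hy hxy
    simp only [mem_compl_iff, mem_union, mem_inter_iff, mem_preimage, not_or, not_and] at hx hy
    exact hYi hx.1 hy.1 (hZi (hx.2 hx.1) (hy.2 hy.1) hxy)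

theorem XiSurjective.comp {κ ξ : Cardinal.{u}} (hξ : AdmissibleIndex κ ξ) {f g : X → X}
    (hg : XiSurjective ξ g) (hf : XiSurjective ξ f) : XiSurjective ξ (g ∘ f) := by
  refine (mk_le_mk_of_subset ?_).trans_lt
    (hξ.mk_union_lt hg ((mk_image_le (f := g) (s := (range f)ᶜ)).trans_lt hf))
  intro y hy
  by_cases hyg : y ∈ range g
  · obtain ⟨x, rfl⟩ := hyg
    refine Or.inr ⟨x, ?_, rfl⟩
    rintro ⟨z, rfl⟩
    exact hy ⟨z, rfl⟩
  · exact Or.inl hyg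

/-- If `g ∘ f` is `ξ`-surjective and `g` is `ξ`-injective, then `f` is `ξ`-surjective. -/
theorem XiSurjective.of_comp_xiInjective {κ ξ : Cardinal.{u}} (hξ : AdmissibleIndex κ ξ)
    {f g : X → X} (h : XiSurjective ξ (g ∘ f)) (hg : XiInjective ξ g) : XiSurjective ξ f := by
  obtain ⟨Y, hY, hYi⟩ := hg
  have hsub : (range f)ᶜ ⊆ Y ∪ ((Yᶜ ∩ (range f)ᶜ) ∩ g ⁻¹' (range (g ∘ f))ᶜ) ∪
      ((Yᶜ ∩ (range f)ᶜ) ∩ g ⁻¹' (g '' Y)) := by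
    intro x hx
    by_cases hxY : x ∈ Y
    · exact Or.inl (Or.inl hxY)
    by_cases hgx : g x ∈ range (g ∘ f)
    · obtain ⟨z, hz⟩ := hgx
      by_cases hfz : f z ∈ Y
      · exact Or.inr ⟨⟨hxY, hx⟩, f z, hfz, hz⟩
      · exact absurd ⟨z, hYi hfz hxY hz⟩ hx
    · exact Or.inl (Or.inr ⟨⟨hxY, hx⟩, hgx⟩)
  have hinj : ∀ T : Set X, #((Yᶜ ∩ (range f)ᶜ) ∩ g ⁻¹' T : Set X) ≤ #T := by
    intro T
    have hi : InjOn g ((Yᶜ ∩ (range f)ᶜ) ∩ g ⁻¹' T) :=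
      hYi.mono (inter_subset_left.trans inter_subset_left)
    rw [← mk_image_eq_of_injOn _ _ hi]
    exact mk_le_mk_of_subset (by rintro _ ⟨x, hx, rfl⟩; exact hx.2)
  exact (mk_le_mk_of_subset hsub).trans_lt
    (hξ.mk_union_lt (hξ.mk_union_lt hY ((hinj _).trans_lt h))
      ((hinj _).trans_lt (mk_image_le.trans_lt hY)))

/-- If `g ∘ f` is `ξ`-injective and `f` is `ξ`-surjective, then `g` is `ξ`-injective. -/
theorem XiInjective.of_comp_xiSurjective {κ ξ : Cardinal.{u}} (hξ : AdmissibleIndex κ ξ)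
    {f g : X → X} (h : XiInjective ξ (g ∘ f)) (hf : XiSurjective ξ f) : XiInjective ξ g := by
  obtain ⟨Y, hY, hYi⟩ := h
  refine ⟨f '' Y ∪ (range f)ᶜ, hξ.mk_union_lt (mk_image_le.trans_lt hY) hf, ?_⟩
  intro x hx y hy hxy
  simp only [mem_compl_iff, mem_union, not_or, not_not] at hx hy
  obtain ⟨hx, a, rfl⟩ := hx
  obtain ⟨hy, b, rfl⟩ := hy
  exact congrArg f (hYi (fun ha => hx ⟨a, ha, rfl⟩) (fun hb => hy ⟨b, hb, rfl⟩) hxy)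

theorem xiInjective_of_injective {ξ : Cardinal.{u}} (hξ : 0 < ξ) {f : X → X}
    (hf : Injective f) : XiInjective ξ f :=
  ⟨∅, by simpa using hξ, hf.injOn⟩

theorem xiSurjective_of_surjective {ξ : Cardinal.{u}} (hξ : 0 < ξ) {f : X → X}
    (hf : Surjective f) : XiSurjective ξ f := by
  have : #((range f)ᶜ : Set X) = 0 := by simp [hf.range_eq]
  exact this.trans_lt hξ

/-- `G_ξ` as a submonoid. -/
def submonoidG (X : Type u) {κ ξ : Cardinal.{u}} (hξ : AdmissibleIndex κ ξ) :
    Submonoid (Function.End X) where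
  carrier := monG X ξ
  one_mem' := Or.inl (xiInjective_of_injective hξ.pos injective_id)
  mul_mem' := by
    intro g f hg hf
    by_cases hs : XiSurjective ξ (g ∘ f)
    · have hgi := hg.resolve_right (not_not_intro hs.of_comp)
      exact Or.inl (hgi.comp hξ
        (hf.resolve_right (not_not_intro (hs.of_comp_xiInjective hξ hgi))))
    · exact Or.inr hs

/-- `M_ξ` as a submonoid. -/
def submonoidM (X : Type u) {κ ξ : Cardinal.{u}} (hξ : AdmissibleIndex κ ξ) :
    Submonoid (Function.End X) where
  carrier := monM X ξ
  one_mem' := Or.inl (xiSurjective_of_surjective hξ.pos surjective_id)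
  mul_mem' := by
    intro g f hg hf
    by_cases hs : XiInjective ξ (g ∘ f)
    · have hfs := hf.resolve_right (not_not_intro hs.of_comp)
      exact Or.inl (XiSurjective.comp hξ
        (hg.resolve_right (not_not_intro (hs.of_comp_xiSurjective hξ hfs))) hfs)
    · exact Or.inr hs

/-- On a set of regular cardinality, `A` is a submonoid. -/
def submonoidA (hreg : (#X).IsRegular) : Submonoid (Function.End X) where
  carrier := monA X
  one_mem' := by
    have : Nonempty X := mk_ne_zero_iff.1 hreg.pos.ne'
    refine mem_monA_of_forall (f := id) fun y => ?_
    rw [preimage_id, mk_singleton]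
    exact one_lt_aleph0.trans_le hreg.aleph0_le
  mul_mem' := by
    intro (g : X → X) (f : X → X) hg hf
    change g ∘ f ∈ monA X
    rw [mem_monA_iff] at *
    refine (mk_le_mk_of_subset (t := {y | ¬ #(g ⁻¹' {y} : Set X) < #X} ∪
      g '' {y | ¬ #(f ⁻¹' {y} : Set X) < #X}) ?_).trans_lt ((mk_union_le _ _).trans_lt
        (Cardinal.add_lt_of_lt hreg.aleph0_le hg (mk_image_le.trans_lt hf)))
    intro y hy
    by_contra hcon
    rw [mem_union, not_or] at hcon
    refine hy ?_
    have : (g ∘ f) ⁻¹' {y} = ⋃ z ∈ g ⁻¹' {y}, f ⁻¹' {z} := by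
      ext x
      simp
    rw [this]
    exact (card_biUnion_lt_iff_forall_of_isRegular hreg (not_not.1 hcon.1)).2
      fun z hz => not_not.1 fun hz' => hcon.2 ⟨z, hz', hz⟩

end Admissible

section Permutations

open Function Set

variable {X : Type u}

theorem range_comp_compl {f g : X → X} (hg : Injective g) :
    (range (g ∘ f))ᶜ = (range g)ᶜ ∪ g '' (range f)ᶜ := by
  rw [range_comp, image_compl_eq_range_sdiff_image hg]
  ext y
  have : y ∈ g '' range f → y ∈ range g := fun ⟨x, _, hx⟩ => ⟨x, hx⟩
  simp only [mem_compl_iff, mem_union, mem_sdiff]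
  tauto

theorem add_mk_compl_range_le {f g : X → X} (hg : Injective g) :
    #((range g)ᶜ : Set X) + #((range f)ᶜ : Set X) ≤ #((range (g ∘ f))ᶜ : Set X) := by
  rw [range_comp_compl hg, mk_union_of_disjoint, mk_image_eq hg]
  exact disjoint_left.2 fun y hy ⟨x, _, hx⟩ => hy ⟨x, hx⟩

/-- A small set can be moved into any set of at least its size by a permutation. -/
theorem exists_perm_mapsTo {C D : Set X} (hC : #C < #X) (hCD : #C ≤ #D) :
    ∃ π : X ≃ X, ∀ x ∈ C, π x ∈ D := by
  obtain ⟨e⟩ := hCD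
  obtain ⟨π, hπ⟩ := extend_function_of_lt (e.trans (Embedding.subtype _)) hC ⟨Equiv.refl X⟩
  exact ⟨π, fun x hx => by rw [hπ ⟨x, hx⟩]; exact (e ⟨x, hx⟩).2⟩

/-- Injections with equally large complements of their ranges differ by a permutation. -/
theorem exists_perm_comp_eq {i j : X → X} (hi : Injective i) (hj : Injective j)
    (h : #((range i)ᶜ : Set X) = #((range j)ᶜ : Set X)) : ∃ π : X ≃ X, ∀ x, π (i x) = j x := by
  obtain ⟨e⟩ := Cardinal.eq.1 h
  let φ : range i ↪ X := (Equiv.ofInjective i hi).symm.toEmbedding.trans ⟨j, hj⟩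
  have hφ : range φ = range j := by
    change range (j ∘ (Equiv.ofInjective i hi).symm) = _
    exact (Equiv.ofInjective i hi).symm.surjective.range_comp j
  obtain ⟨π, hπ⟩ := extend_function φ ⟨e.trans (Equiv.setCongr (by rw [hφ]))⟩
  refine ⟨π, fun x => (hπ ⟨i x, x, rfl⟩).trans ?_⟩
  exact congrArg j (Equiv.ofInjective_symm_apply hi x)

variable {M : Submonoid (Function.End X)}

theorem coe_perm_mem (hSM : permSubmonoid X ≤ M) (π : X ≃ X) : (π : X → X) ∈ M :=
  hSM π.bijective

/-- Powers of an injection which is not surjective omit arbitrarily many points. -/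
theorem natCast_le_mk_compl_range_iterate {i : X → X} (hi : Injective i)
    (hns : ¬ Surjective i) (n : ℕ) : (n : Cardinal.{u}) ≤ #((range i^[n])ᶜ : Set X) := by
  have h1 : 1 ≤ #((range i)ᶜ : Set X) := by
    rw [Cardinal.one_le_iff_ne_zero, mk_ne_zero_iff, nonempty_coe_sort, nonempty_compl]
    exact fun h => hns (range_eq_univ.1 h)
  induction n with
  | zero => simp
  | succ n ih =>
    rw [iterate_succ', Nat.cast_succ, add_comm]
    exact (add_le_add h1 ih).trans (add_mk_compl_range_le hi)

theorem iterate_mem {f : X → X} (hf : f ∈ M) (n : ℕ) : f^[n] ∈ M := by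
  induction n with
  | zero => exact M.one_mem
  | succ n ih => rw [iterate_succ']; exact M.mul_mem hf ih

theorem exists_injective_mem [Infinite X] (hSM : permSubmonoid X ≤ M)
    (hM : ∀ ξ, AdmissibleIndex #X ξ → ∃ g ∈ M, g ∉ monM X ξ) (ξ : Cardinal.{u}) (hξ : ξ ≤ #X) :
    ∃ i ∈ M, Injective i ∧ ξ ≤ #((range i)ᶜ : Set X) := by
  induction ξ using WellFoundedLT.induction with
  | _ ξ ih =>
  rcases lt_or_ge ξ ℵ₀ with hfin | hinf
  · obtain ⟨n, rfl⟩ := lt_aleph0.1 hfin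
    obtain ⟨g : X → X, hgM, hg⟩ := hM 1 (Or.inl rfl)
    replace hg := notMem_monM_iff.1 hg
    obtain ⟨hgs, Y, hY, hgi⟩ := hg
    rw [Cardinal.lt_one_iff, mk_eq_zero_iff, isEmpty_coe_sort] at hY
    subst hY
    have hgi' : Injective g := by rwa [compl_empty, injOn_univ] at hgi
    exact ⟨g^[n], iterate_mem hgM n, hgi'.iterate n, natCast_le_mk_compl_range_iterate hgi'
      (fun h => hgs (xiSurjective_of_surjective zero_lt_one h)) n⟩
  · obtain ⟨g : X → X, hgM, hg⟩ := hM ξ (Or.inr ⟨hinf, hξ⟩)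
    replace hg := notMem_monM_iff.1 hg
    obtain ⟨hgs, Y, hY, hgi⟩ := hg
    obtain ⟨i, hiM, hi, hYi⟩ := ih _ hY (hY.le.trans hξ)
    obtain ⟨π, hπ⟩ := exists_perm_mapsTo (hY.trans_le hξ) hYi
    have hav : ∀ x, π.symm (i x) ∈ Yᶜ := fun x hx => hπ _ hx ⟨x, by simp⟩
    refine ⟨g ∘ π.symm ∘ i, M.mul_mem hgM (M.mul_mem (coe_perm_mem hSM _) hiM), ?_, ?_⟩
    · intro x y hxy
      exact hi (π.symm.injective (hgi (hav x) (hav y) hxy))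
    · exact (not_lt.1 hgs).trans
        (mk_le_mk_of_subset (compl_subset_compl.2 (range_comp_subset_range _ g)))

theorem le_mk_compl_range_surjInv {ξ : Cardinal.{u}} {f : X → X} (hf : Surjective f)
    (h : ¬ XiInjective ξ f) : ξ ≤ #((range (surjInv hf))ᶜ : Set X) := by
  by_contra! hlt
  refine h ⟨_, hlt, ?_⟩
  rw [compl_compl]
  rintro _ ⟨x, rfl⟩ _ ⟨y, rfl⟩ hxy
  rw [surjInv_eq hf, surjInv_eq hf] at hxy
  rw [hxy]

theorem exists_surjective_mem [Infinite X] (hSM : permSubmonoid X ≤ M)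
    (hG : ∀ ξ, AdmissibleIndex #X ξ → ∃ g ∈ M, g ∉ monG X ξ) (ξ : Cardinal.{u}) (hξ : ξ ≤ #X) :
    ∃ f ∈ M, ∃ t : X → X, LeftInverse f t ∧ ξ ≤ #((range t)ᶜ : Set X) := by
  induction ξ using WellFoundedLT.induction with
  | _ ξ ih =>
  rcases lt_or_ge ξ ℵ₀ with hfin | hinf
  · obtain ⟨n, rfl⟩ := lt_aleph0.1 hfin
    obtain ⟨g : X → X, hgM, hg⟩ := hG 1 (Or.inl rfl)
    replace hg := notMem_monG_iff.1 hg
    obtain ⟨hgi, hgs⟩ := hg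
    rw [xiSurjective_iff, Cardinal.lt_one_iff, mk_eq_zero_iff, isEmpty_coe_sort,
      compl_empty_iff, range_eq_univ] at hgs
    have hle := le_mk_compl_range_surjInv hgs hgi
    refine ⟨g^[n], iterate_mem hgM n, (surjInv hgs)^[n],
      (rightInverse_surjInv hgs).iterate n,
      natCast_le_mk_compl_range_iterate (injective_surjInv hgs) (fun h => ?_) n⟩
    rw [h.range_eq] at hle
    simp at hle
  · obtain ⟨g : X → X, hgM, hg⟩ := hG ξ (Or.inr ⟨hinf, hξ⟩)
    replace hg := notMem_monG_iff.1 hg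
    obtain ⟨hgi, hgs⟩ := hg
    obtain ⟨j : X → X, hjM, t, hjt, ht⟩ := ih _ hgs (hgs.le.trans hξ)
    obtain ⟨π, hπ⟩ := exists_perm_mapsTo (hgs.trans_le hξ) ht
    have hs : Surjective (j ∘ π ∘ g) := by
      intro y
      have : π.symm (t y) ∈ range g := by
        by_contra hcon
        exact hπ _ hcon ⟨y, by simp⟩
      obtain ⟨x, hx⟩ := this
      exact ⟨x, by simp [hx, hjt y]⟩
    exact ⟨j ∘ π ∘ g, M.mul_mem hjM (M.mul_mem (coe_perm_mem hSM _) hgM), surjInv hs,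
      rightInverse_surjInv hs,
      le_mk_compl_range_surjInv hs fun h => hgi (h.of_comp (g := j ∘ π))⟩

theorem eq_top_of_forall_exists_notMem [Infinite X] (hSM : permSubmonoid X ≤ M)
    (hA : ∃ h ∈ M, h ∉ monA X)
    (hG : ∀ ξ, AdmissibleIndex #X ξ → ∃ g ∈ M, g ∉ monG X ξ)
    (hM : ∀ ξ, AdmissibleIndex #X ξ → ∃ g ∈ M, g ∉ monM X ξ) : M = ⊤ := by
  obtain ⟨i₀ : X → X, hi₀M, hi₀, hi₀r⟩ := exists_injective_mem hSM hM _ le_rfl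
  obtain ⟨f : X → X, hfM, t, hft, htr⟩ := exists_surjective_mem hSM hG _ le_rfl
  obtain ⟨h : X → X, hhM, hh⟩ := hA
  have hinj : ∀ i : X → X, Injective i → #X ≤ #((range i)ᶜ : Set X) → i ∈ M := by
    intro i hi hir
    obtain ⟨π, hπ⟩ := exists_perm_comp_eq hi₀ hi
      (((mk_set_le _).antisymm hi₀r).trans (hir.antisymm (mk_set_le _)))
    have : i = π ∘ i₀ := funext fun x => (hπ x).symm
    rw [this]
    exact M.mul_mem (coe_perm_mem hSM _) hi₀M
  replace hh := not_lt.1 (mt mem_monA_iff.2 hh)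
  obtain ⟨b⟩ := hh
  have hbi : Injective fun x => (b x : X) := Subtype.val_injective.comp b.injective
  have hti : Injective t := hft.injective
  have hbt : #X ≤ #((range ((fun x => (b x : X)) ∘ t))ᶜ : Set X) :=
    htr.trans (le_add_self.trans (add_mk_compl_range_le hbi))
  obtain ⟨π, hπ⟩ := exists_perm_comp_eq (hbi.comp hti) hti
    (((mk_set_le _).antisymm hbt).trans (htr.antisymm (mk_set_le _)))
  have hφ : ∀ y : X, ∃ φ : X → X, Injective φ ∧ ∀ x, h (φ x) = b y := by
    intro y
    obtain ⟨φ⟩ := not_lt.1 (b y).2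
    exact ⟨fun x => φ x, Subtype.val_injective.comp φ.injective, fun x => (φ x).2⟩
  choose φ hφi hφh using hφ
  rw [eq_top_iff]
  intro (F : X → X) _
  let i : X → X := fun x => φ (t (F x)) (t x)
  have hi : Injective i := by
    intro x y hxy
    have h1 := congrArg h hxy
    simp only [i, hφh] at h1
    have h2 := hbi h1
    simp only [i, h2] at hxy
    exact hti (hφi _ hxy)
  have hir : #X ≤ #((range i)ᶜ : Set X) := by
    obtain ⟨x₀⟩ := (inferInstance : Nonempty X)
    refine htr.trans ?_
    rw [← mk_image_eq (s := (range t)ᶜ) (hφi (t (F x₀)))]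
    refine mk_le_mk_of_subset ?_
    rintro _ ⟨z, hz, rfl⟩ ⟨x, hx⟩
    have h1 := congrArg h hx
    simp only [i, hφh] at h1
    have h2 := hbi h1
    simp only [i, h2] at hx
    exact hz ⟨x, hφi _ hx⟩
  have hF : F = f ∘ π ∘ h ∘ i := by
    funext x
    have h1 : π (b (t (F x))) = t (F x) := hπ (F x)
    simp [i, hφh, h1, hft (F x)]
  rw [hF]
  exact M.mul_mem hfM (M.mul_mem (coe_perm_mem hSM _) (M.mul_mem hhM (hinj i hi hir)))

end Permutations

section Witnesses

open Function Set

variable (X : Type u) [Infinite X]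

theorem exists_injective_mk_compl_range {c : Cardinal.{u}} (hc : c ≤ #X) :
    ∃ i : X → X, Injective i ∧ #((range i)ᶜ : Set X) = c := by
  obtain ⟨Z, rfl⟩ := le_mk_iff_exists_set.1 hc
  obtain ⟨e⟩ : Nonempty (X ⊕ Z ≃ X) := Cardinal.eq.1 <| by
    rw [mk_sum, lift_id, lift_id, add_eq_left (aleph0_le_mk X) hc]
  refine ⟨e ∘ Sum.inl, e.injective.comp Sum.inl_injective, ?_⟩
  rw [range_comp, ← image_compl_eq e.bijective, mk_image_eq e.injective, compl_range_inl,
    mk_range_eq _ Sum.inr_injective]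

theorem exists_surjective_xiInjective_iff {d : Cardinal.{u}} (hd : d ≤ #X) :
    ∃ s : X → X, Surjective s ∧ (∀ ξ, XiInjective ξ s ↔ d < ξ) ∧
      ∀ y, (s ⁻¹' {y}).Finite := by
  obtain ⟨Z, rfl⟩ := le_mk_iff_exists_set.1 hd
  obtain ⟨e⟩ : Nonempty (X ≃ X ⊕ Z) := Cardinal.eq.1 <| by
    rw [mk_sum, lift_id, lift_id, add_eq_left (aleph0_le_mk X) hd]
  let p : X ⊕ Z → X := Sum.elim id Subtype.val
  refine ⟨p ∘ e, fun y => ⟨e.symm (Sum.inl y), by simp [p]⟩, fun ξ => ⟨?_, ?_⟩, fun y => ?_⟩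
  · rintro ⟨Y, hY, hinj⟩
    refine lt_of_le_of_lt ?_ hY
    classical
    have hmem : ∀ z : Z, e.symm (Sum.inl z.1) ∉ Y → e.symm (Sum.inr z) ∈ Y := by
      intro z h1
      by_contra h2
      have := hinj h1 h2 (by simp [p])
      simp at this
    refine mk_le_of_injective (f := fun z : Z => if h : e.symm (Sum.inl z.1) ∈ Y
      then (⟨_, h⟩ : Y) else ⟨_, hmem z h⟩) ?_
    intro z w hzw
    have := congrArg (fun y : Y => p (e y)) hzw
    apply Subtype.ext
    dsimp only at this
    split_ifs at this <;> simpa [p] using this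
  · intro h
    refine ⟨range (e.symm ∘ Sum.inr), ?_, ?_⟩
    · rwa [mk_range_eq _ (e.symm.injective.comp Sum.inr_injective)]
    · have key : ∀ x ∉ range (e.symm ∘ Sum.inr), e x = Sum.inl (p (e x)) := by
        intro x hx
        rcases hex : e x with a | z
        · rfl
        · exact absurd ⟨z, by simp [← hex]⟩ hx
      intro x hx y hy hxy
      refine e.injective ?_
      rw [key x hx, key y hy]
      exact congrArg _ hxy
  · rw [preimage_comp]
    refine Finite.preimage e.injective.injOn ?_
    have : p ⁻¹' {y} ⊆ {Sum.inl y} ∪ Sum.inr '' (Subtype.val ⁻¹' {y} : Set Z) := by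
      rintro (a | z) ha
      · exact Or.inl (congrArg _ ha)
      · exact Or.inr ⟨z, ha, rfl⟩
    exact ((finite_singleton _).union
      (((finite_singleton y).preimage Subtype.val_injective.injOn).image _)).subset this

/-- A function in `A` with prescribed amounts of non-surjectivity and non-injectivity. -/
theorem exists_mem_monA {c d : Cardinal.{u}} (hc : c ≤ #X) (hd : d ≤ #X) :
    ∃ f ∈ monA X, (∀ ξ, XiSurjective ξ f ↔ c < ξ) ∧ ∀ ξ, XiInjective ξ f ↔ d < ξ := by
  obtain ⟨i, hi, hic⟩ := exists_injective_mk_compl_range X hc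
  obtain ⟨s, hs, hsd, hsf⟩ := exists_surjective_xiInjective_iff X hd
  refine ⟨i ∘ s, ?_, fun ξ => ?_, fun ξ => ?_⟩
  · refine mem_monA_of_forall fun y => ?_
    have hfin : ((i ∘ s) ⁻¹' {y}).Finite := by
      by_cases hy : y ∈ range i
      · obtain ⟨x, rfl⟩ := hy
        exact (hsf x).subset fun z hz => hi hz
      · convert finite_empty
        exact eq_empty_of_forall_notMem fun z hz => hy ⟨_, hz⟩
    exact (lt_aleph0_iff_set_finite.2 hfin).trans_le (aleph0_le_mk X)
  · rw [xiSurjective_iff, hs.range_comp, hic]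
  · rw [← hsd]
    exact exists_congr fun Y => and_congr_right fun _ =>
      ⟨fun h x hx y hy hxy => h hx hy (congrArg i hxy),
        fun h x hx y hy hxy => h hx hy (hi hxy)⟩

/-- A function outside of `A` with a prescribed amount of non-surjectivity. -/
theorem exists_notMem_monA {c : Cardinal.{u}} (hc : c ≤ #X) :
    ∃ f ∉ monA X, ∀ ξ, XiSurjective ξ f ↔ c < ξ := by
  obtain ⟨i, hi, hic⟩ := exists_injective_mk_compl_range X hc
  obtain ⟨e⟩ : Nonempty (X ≃ X × X) := Cardinal.eq.1 <| by simp
  have hs : Surjective (Prod.fst ∘ e) := fun y => ⟨e.symm (y, y), by simp⟩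
  refine ⟨i ∘ Prod.fst ∘ e, ?_, fun ξ => by rw [xiSurjective_iff, hs.range_comp, hic]⟩
  refine mt mem_monA_iff.1 (not_lt.2 ?_)
  refine (mk_range_eq i hi).symm.le.trans (mk_le_mk_of_subset ?_)
  rintro _ ⟨y, rfl⟩
  refine not_lt.2 ?_
  exact mk_le_of_injective (f := fun x => (⟨e.symm (y, x), by simp⟩ :
    (i ∘ Prod.fst ∘ e) ⁻¹' {i y})) fun a b hab => by simpa using hab

end Witnesses

section Listed

open Function Set

variable {X : Type u}

/-- The sets `A`, `G_ξ` and `M_ξ`, for `ξ = 1` or `ℵ₀ ≤ ξ ≤ κ`. -/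
def MaximalCandidate (κ : Cardinal.{u}) (L : Set (Function.End X)) : Prop :=
  L = monA X ∨ ∃ ξ, AdmissibleIndex κ ξ ∧ (L = monG X ξ ∨ L = monM X ξ)

theorem MaximalCandidate.exists_submonoid (hreg : (#X).IsRegular) {L : Set (Function.End X)}
    (hL : MaximalCandidate #X L) : ∃ N : Submonoid (Function.End X), (N : Set _) = L := by
  rcases hL with rfl | ⟨ξ, hξ, rfl | rfl⟩
  · exact ⟨submonoidA hreg, rfl⟩
  · exact ⟨submonoidG X hξ, rfl⟩
  · exact ⟨submonoidM X hξ, rfl⟩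

variable [Infinite X]

theorem MaximalCandidate.ne_univ {L : Set (Function.End X)} (hL : MaximalCandidate #X L) :
    L ≠ Set.univ := by
  rw [ne_univ_iff_exists_notMem]
  have h0 : 0 ≤ #X := zero_le
  rcases hL with rfl | ⟨ξ, hξ, rfl | rfl⟩
  · obtain ⟨f, hf, -⟩ := exists_notMem_monA X h0
    exact ⟨f, hf⟩
  · obtain ⟨f, -, hs, hi⟩ := exists_mem_monA X h0 le_rfl
    exact ⟨f, by simp [monG, hs, hi, hξ.pos, hξ.le (aleph0_le_mk X)]⟩
  · obtain ⟨f, -, hs, hi⟩ := exists_mem_monA X le_rfl h0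
    exact ⟨f, by simp [monM, hs, hi, hξ.pos, hξ.le (aleph0_le_mk X)]⟩

theorem MaximalCandidate.eq_of_subset {L L' : Set (Function.End X)}
    (hL : MaximalCandidate #X L) (hL' : MaximalCandidate #X L') (h : L ⊆ L') : L = L' := by
  have h0 : 0 ≤ #X := zero_le
  have hX := aleph0_le_mk X
  rcases hL with rfl | ⟨ξ, hξ, rfl | rfl⟩ <;> rcases hL' with rfl | ⟨η, hη, rfl | rfl⟩
  · rfl
  · obtain ⟨f, hf, hs, hi⟩ := exists_mem_monA X h0 le_rfl
    have := h hf
    simp [monG, hs, hi, hη.pos, (hη.le hX).not_gt] at this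
  · obtain ⟨f, hf, hs, hi⟩ := exists_mem_monA X le_rfl h0
    have := h hf
    simp [monM, hs, hi, hη.pos, (hη.le hX).not_gt] at this
  · obtain ⟨f, hf, hs⟩ := exists_notMem_monA X le_rfl
    exact absurd (h (Or.inr (by simp [hs, hξ.le hX]))) hf
  · rcases lt_trichotomy ξ η with hlt | rfl | hlt
    · obtain ⟨f, -, hs, hi⟩ := exists_mem_monA X (hξ.le hX) le_rfl
      have := h (Or.inr (by simp [hs]) : f ∈ monG X ξ)
      simp [monG, hs, hi, hlt, (hη.le hX).not_gt] at this
    · rfl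
    · obtain ⟨f, -, hs, hi⟩ := exists_mem_monA X h0 (hη.le hX)
      have := h (Or.inl (by simp [hi, hlt]) : f ∈ monG X ξ)
      simp [monG, hs, hi, hη.pos] at this
  · obtain ⟨f, -, hs, hi⟩ := exists_mem_monA X le_rfl h0
    have := h (Or.inl (by simp [hi, hξ.pos]) : f ∈ monG X ξ)
    simp [monM, hs, hi, hη.pos, (hη.le hX).not_gt] at this
  · obtain ⟨f, hf, hs⟩ := exists_notMem_monA X h0
    exact absurd (h (Or.inl (by simp [hs, hξ.pos]))) hf
  · obtain ⟨f, -, hs, hi⟩ := exists_mem_monA X h0 le_rfl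
    have := h (Or.inl (by simp [hs, hξ.pos]) : f ∈ monM X ξ)
    simp [monG, hs, hi, hη.pos, (hη.le hX).not_gt] at this
  · rcases lt_trichotomy ξ η with hlt | rfl | hlt
    · obtain ⟨f, -, hs, hi⟩ := exists_mem_monA X le_rfl (hξ.le hX)
      have := h (Or.inr (by simp [hi]) : f ∈ monM X ξ)
      simp [monM, hs, hi, hlt, (hη.le hX).not_gt] at this
    · rfl
    · obtain ⟨f, -, hs, hi⟩ := exists_mem_monA X (hη.le hX) h0
      have := h (Or.inl (by simp [hs, hlt]) : f ∈ monM X ξ)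
      simp [monM, hs, hi, hη.pos] at this

theorem exists_maximalCandidate_superset {M : Submonoid (Function.End X)}
    (hSM : permSubmonoid X ≤ M) (hM : M ≠ ⊤) :
    ∃ L : Set (Function.End X), MaximalCandidate #X L ∧ (M : Set _) ⊆ L := by
  by_contra! hcon
  have key : ∀ L : Set (Function.End X), MaximalCandidate #X L → ∃ f ∈ M, f ∉ L :=
    fun L hL => not_subset.1 (hcon L hL)
  exact hM (eq_top_of_forall_exists_notMem hSM (key _ (Or.inl rfl))
    (fun ξ hξ => key _ (Or.inr ⟨ξ, hξ, Or.inl rfl⟩))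
    fun ξ hξ => key _ (Or.inr ⟨ξ, hξ, Or.inr rfl⟩))

theorem precomplete_iff_maximalCandidate (hreg : (#X).IsRegular)
    {M : Submonoid (Function.End X)} (hSM : permSubmonoid X ≤ M) :
    Precomplete M ↔ MaximalCandidate #X (M : Set (Function.End X)) := by
  constructor
  · rintro ⟨hne, hgen⟩
    obtain ⟨L, hL, hML⟩ := exists_maximalCandidate_superset hSM hne
    obtain ⟨N, rfl⟩ := hL.exists_submonoid hreg
    suffices h : (N : Set (Function.End X)) ⊆ M by rwa [hML.antisymm h]
    intro f hf
    by_contra hfM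
    have hle : Submonoid.closure ((M : Set (Function.End X)) ∪ {f}) ≤ N :=
      Submonoid.closure_le.2 (union_subset hML (singleton_subset_iff.2 hf))
    rw [hgen f hfM, top_le_iff] at hle
    exact hL.ne_univ (by rw [hle, Submonoid.coe_top])
  · intro hL
    refine ⟨fun h => hL.ne_univ (by rw [h, Submonoid.coe_top]), fun f hf => ?_⟩
    by_contra hne
    have hsub := Submonoid.subset_closure (s := (M : Set (Function.End X)) ∪ {f})
    obtain ⟨L, hL', hsup⟩ := exists_maximalCandidate_superset
      (hSM.trans fun g hg => hsub (Or.inl hg)) hne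
    have heq := hL.eq_of_subset hL' fun g hg => hsup (hsub (Or.inl hg))
    exact hf (heq.symm.subset (hsup (hsub (Or.inr rfl))))

end Listed

/-- Theorem 1 (regular case): on an infinite set of regular cardinality `κ`, the precomplete
submonoids of the full transformation monoid containing all permutations are exactly
`A`, and `G_ξ`, `M_ξ` for `ξ = 1` and for infinite cardinals `ℵ₀ ≤ ξ ≤ κ`. -/
theorem precomplete_monoids_above_S_regular {X : Type u} [Infinite X] {κ : Cardinal.{u}}
    (hκ : #X = κ) (hreg : κ.IsRegular)
    (M : Submonoid (Function.End X)) (hSM : permSubmonoid X ≤ M) :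
    Precomplete M ↔
      ((M : Set (Function.End X)) = monA X ∨
        ∃ ξ : Cardinal.{u}, (ξ = 1 ∨ (ℵ₀ ≤ ξ ∧ ξ ≤ κ)) ∧
          ((M : Set (Function.End X)) = monG X ξ ∨
            (M : Set (Function.End X)) = monM X ξ)) := by
  subst hκ
  exact precomplete_iff_maximalCandidate hreg hSM
end

section
/- Let X be an infinite set of regular cardinality κ = ℵ_α, let λ = max(|α|, ℵ₀), and let G be any precomplete submonoid of the full transformation monoid O^(1) containing the group S of all permutations. Then the interval [S, G] = {M : M a submonoid of O^(1), S ⊆ M ⊆ G} has cardinality 2^(2^λ), where here S denotes the submonoid consisting of all permutations. -/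
open Cardinal

universe u

open Function

section Permutations

variable {X : Type u}

theorem mem_of_perm {G : Submonoid (Function.End X)} (hS : permSubmonoid X ≤ G)
    (π : Equiv.Perm X) : (π : X → X) ∈ G :=
  hS π.bijective

theorem comp_mem {G : Submonoid (Function.End X)} {f g : X → X} (hf : f ∈ G) (hg : g ∈ G) :
    f ∘ g ∈ G :=
  G.mul_mem (x := f) (y := g) hf hg

theorem exists_perm_comp_eq_s3 {q r : X → X} (hq : Injective q) (hr : Injective r)
    (h : #((Set.range q)ᶜ : Set X) = #((Set.range r)ᶜ : Set X)) :
    ∃ π : Equiv.Perm X, ∀ x, π (q x) = r x := by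
  classical
  obtain ⟨e⟩ := Cardinal.eq.1 h
  refine ⟨(Equiv.Set.sumCompl (Set.range q)).symm.trans
    ((Equiv.sumCongr ((Equiv.ofInjective q hq).symm.trans (Equiv.ofInjective r hr)) e).trans
      (Equiv.Set.sumCompl (Set.range r))), fun x => ?_⟩
  have : (Equiv.ofInjective q hq).symm ⟨q x, Set.mem_range_self x⟩ = x :=
    (Equiv.ofInjective q hq).symm_apply_apply x
  simp only [Equiv.trans_apply, Equiv.sumCongr_apply, this, Sum.map_inl,
    Equiv.Set.sumCompl_symm_apply_of_mem (Set.mem_range_self x), Equiv.Set.sumCompl_apply_inl,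
    Equiv.ofInjective_apply]

theorem mk_compl_range_eq_of_le {f : X → X} {Z : Set X} (hZ : #Z = #X)
    (h : Z ⊆ (Set.range f)ᶜ) : #((Set.range f)ᶜ : Set X) = #X :=
  le_antisymm (mk_set_le _) (hZ ▸ mk_le_mk_of_subset h)

theorem mk_compl_range_comp {v w : X → X} (hw : Injective w)
    (hv : #((Set.range v)ᶜ : Set X) = #X) : #((Set.range (w ∘ v))ᶜ : Set X) = #X := by
  refine mk_compl_range_eq_of_le (Z := w '' (Set.range v)ᶜ) ((mk_image_eq hw).trans hv) ?_
  rintro _ ⟨x, hx, rfl⟩ ⟨y, hy⟩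
  exact hx ⟨y, hw hy⟩

theorem exists_injective_mk_compl_range_s3 [Infinite X] :
    ∃ v : X → X, Injective v ∧ #((Set.range v)ᶜ : Set X) = #X := by
  obtain ⟨e⟩ : Nonempty (X ⊕ X ≃ X) :=
    Cardinal.eq.1 (by rw [mk_sum, lift_id, add_eq_self (aleph0_le_mk X)])
  refine ⟨e ∘ Sum.inl, e.injective.comp Sum.inl_injective,
    mk_compl_range_eq_of_le (Z := Set.range (e ∘ Sum.inr))
      (mk_range_eq _ (e.injective.comp Sum.inr_injective)) ?_⟩
  rintro _ ⟨x, rfl⟩ ⟨y, hy⟩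
  simpa using e.injective hy

end Permutations

section Precomplete

variable {X : Type u} {G : Submonoid (Function.End X)}

/-- A submonoid containing the permutations, all injections with large co-range, a surjection
with large kernel and a function with many large fibers is the full transformation monoid. -/
theorem eq_top_of_injective_of_surjective_of_notMem_monA [Infinite X]
    (hS : permSubmonoid X ≤ G)
    (hinj : ∀ v : X → X, Injective v → #((Set.range v)ᶜ : Set X) = #X → v ∈ G)
    {u : X → X} (hu : u ∈ G) {Z : Set X} (hZ : #Z = #X) (huZ : ∀ x, ∃ z ∉ Z, u z = x)
    {a : X → X} (ha : a ∈ G) (haA : a ∉ monA X) : G = ⊤ := by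
  refine eq_top_iff.2 fun t _ => ?_
  obtain ⟨i, hi, hic⟩ := exists_injective_mk_compl_range_s3 (X := X)
  choose r hrZ hr using huZ
  have hr_inj : Injective r := (show LeftInverse u r from hr).injective
  have hrc : #((Set.range r)ᶜ : Set X) = #X :=
    mk_compl_range_eq_of_le hZ fun z hz ⟨x, hx⟩ => hrZ x (hx ▸ hz)
  have hY : #{y : X | ¬ #(a ⁻¹' {y}) < #X} = #X :=
    le_antisymm (mk_set_le _) (not_lt.1 haA)
  obtain ⟨j⟩ := Cardinal.eq.1 hY.symm
  set q : X → X := (fun x => (j x : X)) ∘ i with hq_def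
  have hj_inj : Injective fun x => (j x : X) := Subtype.val_injective.comp j.injective
  obtain ⟨π, hπ⟩ := exists_perm_comp_eq_s3 (hj_inj.comp hi) hr_inj
    ((mk_compl_range_comp hj_inj hic).trans hrc.symm)
  have hfib : ∀ y, Nonempty (X ↪ (a ⁻¹' {q y} : Set X)) := fun y =>
    not_lt.1 (j (i y)).2
  let k := fun y => (hfib y).some
  have hk : ∀ y x, a (k y x) = q y := fun y x => (k y x).2
  let v : X → X := fun x => k (t x) (i x)
  have hv : Injective v := by
    intro x y hxy
    have h1 : q (t x) = q (t y) :=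
      (hk _ (i x)).symm.trans ((congrArg a hxy).trans (hk _ (i y)))
    have h2 : t x = t y := (hj_inj.comp hi) h1
    have h3 : (k (t x) (i x) : X) = k (t x) (i y) := by
      have : (k (t x) (i x) : X) = k (t y) (i y) := hxy
      rwa [← h2] at this
    exact hi ((k (t x)).injective (Subtype.ext h3))
  have hvc : #((Set.range v)ᶜ : Set X) = #X := by
    obtain ⟨x₀⟩ : Nonempty X := inferInstance
    have hkinj : Injective fun x => (k (t x₀) x : X) :=
      Subtype.val_injective.comp (k (t x₀)).injective
    refine mk_compl_range_eq_of_le (Z := (fun x => (k (t x₀) x : X)) '' (Set.range i)ᶜ)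
      ((mk_image_eq hkinj).trans hic) ?_
    rintro _ ⟨x, hx, rfl⟩ ⟨y, hy⟩
    have hy : (k (t y) (i y) : X) = k (t x₀) x := hy
    have h1 : q (t y) = q (t x₀) :=
      (hk _ (i y)).symm.trans ((congrArg a hy).trans (hk _ x))
    rw [(hj_inj.comp hi) h1] at hy
    exact hx ⟨y, hkinj hy⟩
  have key : u ∘ π ∘ a ∘ v = t := by
    funext x
    change u (π (a (k (t x) (i x)))) = t x
    rw [hk, hq_def, hπ, hr]
  exact key ▸ comp_mem hu (comp_mem (mem_of_perm hS π) (comp_mem ha (hinj v hv hvc)))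

theorem monA_mul_mem [Infinite X] (hreg : (#X).IsRegular) {f g : Function.End X}
    (hf : f ∈ monA X) (hg : g ∈ monA X) : f * g ∈ monA X := by
  refine lt_of_le_of_lt (mk_le_mk_of_subset
    (t := {y : X | ¬ #(f ⁻¹' {y}) < #X} ∪ f '' {x : X | ¬ #(g ⁻¹' {x}) < #X}) ?_)
    ((mk_union_le _ _).trans_lt
      (add_lt_of_lt (aleph0_le_mk X) hf (mk_image_le.trans_lt hg)))
  intro y hy
  by_contra hcon
  rw [Set.mem_union, not_or] at hcon
  refine hy ?_
  have : (f * g) ⁻¹' {y} = ⋃ x ∈ f ⁻¹' {y}, g ⁻¹' {x} := by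
    ext z
    simp only [Set.mem_iUnion, exists_prop]
    refine ⟨fun h => ⟨g z, h, rfl⟩, ?_⟩
    rintro ⟨_, hx, rfl⟩
    exact hx
  rw [this, card_biUnion_lt_iff_forall_of_isRegular hreg (not_not.1 hcon.1)]
  intro x hx
  by_contra h
  exact hcon.2 ⟨x, h, hx⟩

/-- A function with co-range and kernel of full size and with few large fibers lies in every
precomplete submonoid containing the permutations. -/
theorem Precomplete.mem_of_mk_compl_range [Infinite X] (hreg : (#X).IsRegular)
    (hG : Precomplete G) (hS : permSubmonoid X ≤ G) {f : Function.End X}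
    (hc : #((Set.range f)ᶜ : Set X) = #X)
    (hd : ∀ Y : Set X, Set.InjOn f Yᶜ → #Y = #X) (hA : f ∈ monA X) : f ∈ G := by
  by_contra hf
  have htop := hG.2 f hf
  have hall : ∀ w : Function.End X,
      w ∈ Submonoid.closure ((G : Set (Function.End X)) ∪ {f}) := fun w => htop ▸ trivial
  refine hG.1 ?_
  have hinj : ∃ v ∈ G, Injective v ∧ #((Set.range v)ᶜ : Set X) = #X := by
    by_contra! hno
    have hP : ∀ w : Function.End X, ∀ v ∈ G, Injective (w * v) → w * v ∈ G := by
      intro w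
      induction hall w using Submonoid.closure_induction with
      | mem w hw =>
        intro v hv hwv
        rcases hw with hw | rfl
        · exact G.mul_mem hw hv
        · refine absurd (hd _ ?_) (hno v hv (Injective.of_comp hwv))
          rw [compl_compl]
          rintro _ ⟨x, rfl⟩ _ ⟨y, rfl⟩ hxy
          exact congrArg v (hwv hxy)
      | one => intro v hv _; simpa using hv
      | mul w₁ w₂ _ _ h₁ h₂ =>
        intro v hv h
        rw [mul_assoc] at h ⊢
        exact h₁ _ (h₂ v hv (Injective.of_comp h)) h
    obtain ⟨i, hi, hic⟩ := exists_injective_mk_compl_range_s3 (X := X)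
    have hiG : i ∈ G := hP i 1 G.one_mem hi
    exact hno i hiG hi hic
  have hsurj : ∃ v ∈ G, ∃ Z : Set X, #Z = #X ∧ ∀ x, ∃ z ∉ Z, v z = x := by
    by_contra! hno
    have hP : ∀ w : Function.End X, ∀ v ∈ G, Surjective (v * w) → v * w ∈ G := by
      intro w
      induction hall w using Submonoid.closure_induction with
      | mem w hw =>
        intro v hv hwv
        rcases hw with hw | rfl
        · exact G.mul_mem hv hw
        · obtain ⟨x, hx⟩ := hno v hv _ hc
          obtain ⟨y, hy⟩ := hwv x
          exact absurd hy (hx (w y) (not_not.2 (Set.mem_range_self y)))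
      | one => intro v hv _; simpa using hv
      | mul w₁ w₂ _ _ h₁ h₂ =>
        intro v hv h
        rw [← mul_assoc] at h ⊢
        exact h₂ _ (h₁ v hv (Surjective.of_comp h)) h
    obtain ⟨i, hi, hic⟩ := exists_injective_mk_compl_range_s3 (X := X)
    have hs : Surjective (invFun i) := invFun_surjective hi
    have hiG : invFun i ∈ G := hP (invFun i) 1 G.one_mem hs
    obtain ⟨x, hx⟩ := hno _ hiG _ hic
    exact hx (i x) (not_not.2 (Set.mem_range_self x)) (leftInverse_invFun hi x)
  have hbig : ∃ a ∈ G, a ∉ monA X := by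
    by_contra! hno
    have hP : ∀ w : Function.End X, w ∈ monA X := by
      intro w
      induction hall w using Submonoid.closure_induction with
      | mem w hw => exact hw.elim (hno w) fun h => h ▸ hA
      | one => exact hno _ G.one_mem
      | mul w₁ w₂ _ _ h₁ h₂ => exact monA_mul_mem hreg h₁ h₂
    obtain ⟨e⟩ : Nonempty (X × X ≃ X) :=
      Cardinal.eq.1 (by rw [mk_prod, lift_id, mul_eq_self (aleph0_le_mk X)])
    have hfib : ∀ y, #((fun x => (e.symm x).1) ⁻¹' {y} : Set X) = #X := fun y =>
      le_antisymm (mk_set_le _) (mk_le_of_injective (f := fun x => ⟨e (y, x), by simp⟩)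
        fun x x' h => by simpa using h)
    refine (hP fun x => (e.symm x).1).not_ge (mk_univ.symm.trans_le (mk_le_mk_of_subset ?_))
    exact fun y _ => (hfib y).not_lt
  obtain ⟨v, hv, hv_inj, hvc⟩ := hinj
  obtain ⟨u, hu, Z, hZ, huZ⟩ := hsurj
  obtain ⟨a, ha, haA⟩ := hbig
  refine eq_top_of_injective_of_surjective_of_notMem_monA hS (fun w hw hwc => ?_) hu hZ huZ ha haA
  obtain ⟨π, hπ⟩ := exists_perm_comp_eq_s3 hv_inj hw (hvc.trans hwc.symm)
  have : π ∘ v = w := funext hπ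
  exact this ▸ comp_mem (mem_of_perm hS π) hv

end Precomplete

section LowerBound

variable {X : Type u} {T : Type u}

/-- A family of functions indexed by sets of cardinals which grow fast enough that a set `A` can
be read off from any function having the function with index `A` as a left multiple. -/
theorem exists_family_of_sum_lt [Infinite X] (s : T → Cardinal.{u}) (hs : Injective s)
    (hT : #T ≤ #X) (hlt : ∀ t, s t < #X)
    (hsum : ∀ t, Cardinal.sum (fun t' : {t' // s t' < s t} => s t') < s t) :
    ∃ F : Set T → X → X, (∀ A, #((Set.range (F A))ᶜ : Set X) = #X) ∧
      (∀ A (Y : Set X), Set.InjOn (F A) Yᶜ → #Y = #X) ∧ (∀ A, F A ∈ monA X) ∧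
      ∀ A B (p : X → X) (π : Equiv.Perm X), p ∘ F B ∘ π = F A → A ⊆ B := by
  have hX := aleph0_le_mk X
  obtain ⟨i, hi, hic⟩ := exists_injective_mk_compl_range_s3 (X := X)
  obtain ⟨e₀⟩ : Nonempty (Option T ↪ X) := by
    rw [← Cardinal.le_def, mk_option]
    exact add_le_of_le hX hT (one_le_aleph0.trans hX)
  let e : Option T → X := i ∘ e₀
  have he : Injective e := hi.comp e₀.injective
  have hE : ∀ A : Set T, Nonempty (X ⊕ (Σ t : A, (s t).out) ≃ X) := by
    intro A
    refine Cardinal.eq.1 ?_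
    rw [mk_sum, lift_id, lift_id]
    refine add_eq_left hX ?_
    rw [mk_sigma]
    calc Cardinal.sum (fun t : A => #(s t).out) ≤ Cardinal.sum (fun _ : A => #X) :=
          sum_le_sum _ _ fun t => by rw [mk_out]; exact (hlt t).le
      _ = #A * #X := sum_const' _ _
      _ ≤ #X := mul_le_of_le hX ((mk_set_le A).trans hT) le_rfl
  let E := fun A => (hE A).some
  let F : Set T → X → X := fun A =>
    Sum.elim (fun _ => e none) (fun z => e (some z.1)) ∘ (E A).symm
  have hF : ∀ A x, F A x = e none ∨ ∃ t ∈ A, F A x = e (some t) := by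
    intro A x
    obtain ⟨z, rfl⟩ := (E A).surjective x
    rcases z with z | z
    · exact Or.inl (by simp [F])
    · exact Or.inr ⟨z.1, z.1.2, by simp [F]⟩
  have hnone : ∀ A, #(F A ⁻¹' {e none}) = #X := fun A =>
    le_antisymm (mk_set_le _) (mk_le_of_injective (f := fun x => ⟨E A (Sum.inl x), by simp [F]⟩)
      fun x y h => by simpa using h)
  have hsome : ∀ A t, t ∈ A → #(F A ⁻¹' {e (some t)}) = s t := by
    intro A t ht
    have : F A ⁻¹' {e (some t)} =
        Set.range fun w : (s t).out => E A (Sum.inr ⟨⟨t, ht⟩, w⟩) := by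
      ext x
      obtain ⟨z, rfl⟩ := (E A).surjective x
      rcases z with z | ⟨⟨t', ht'⟩, w⟩
      · simp [F, he.eq_iff]
      · simp only [Set.mem_preimage, Function.comp_apply, Equiv.symm_apply_apply, Sum.elim_inr,
          Set.mem_singleton_iff, he.eq_iff, Option.some.injEq, Set.mem_range,
          EmbeddingLike.apply_eq_iff_eq, Sum.inr.injEq, F]
        constructor
        · rintro rfl
          exact ⟨w, rfl⟩
        · rintro ⟨w', hw'⟩
          exact (congrArg (fun z => (z.1 : T)) hw').symm
    rw [this, mk_range_eq _ fun w w' h => by simpa using h, mk_out]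
  refine ⟨F, fun A => ?_, fun A Y hY => ?_, fun A => ?_, fun A B p π h t ht => ?_⟩
  · refine mk_compl_range_eq_of_le hic fun x hx ⟨y, hy⟩ => hx ?_
    rcases hF A y with h | ⟨t, -, h⟩
    · exact ⟨e₀ none, h.symm.trans hy⟩
    · exact ⟨e₀ (some t), h.symm.trans hy⟩
  · by_contra hlt'
    have hYlt : #Y < #X := lt_of_le_of_ne (mk_set_le _) hlt'
    have hsub : (F A ⁻¹' {e none} \ Y).Subsingleton := fun x hx y hy =>
      hY hx.2 hy.2 (Eq.trans (show F A x = e none from hx.1) (Eq.symm hy.1))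
    refine (hnone A).not_lt (lt_of_le_of_lt (mk_le_mk_of_subset
      (t := (F A ⁻¹' {e none} \ Y) ∪ Y) fun x hx => ?_) ((mk_union_le _ _).trans_lt
        (add_lt_of_lt hX (lt_of_le_of_lt ?_ (one_lt_aleph0.trans_le hX)) hYlt)))
    · by_cases hxY : x ∈ Y
      · exact Or.inr hxY
      · exact Or.inl ⟨hx, hxY⟩
    · exact mk_le_one_iff_set_subsingleton.2 hsub
  · suffices ∀ y, ¬ #(F A ⁻¹' {y}) < #X → y = e none from
      (mk_le_mk_of_subset (t := {e none}) this).trans_lt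
        ((mk_singleton _).trans_lt (one_lt_aleph0.trans_le hX))
    intro y hy
    obtain ⟨x, hx⟩ : (F A ⁻¹' {y}).Nonempty := by
      by_contra hne
      rw [Set.not_nonempty_iff_eq_empty] at hne
      refine hy ?_
      rw [hne, mk_eq_zero]
      exact aleph0_pos.trans_le hX
    rcases hF A x with h | ⟨t, ht, h⟩
    · exact Eq.trans (Eq.symm hx) h
    · obtain rfl : e (some t) = y := h.symm.trans hx
      exact absurd (hsome A t ht ▸ hlt t) hy
  · by_contra htB
    have hle : ∀ z, p z = e (some t) → #(F B ⁻¹' {z}) ≤ s t := by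
      intro z hz
      rw [← hsome A t ht, ← mk_image_eq π.symm.injective]
      refine mk_le_mk_of_subset ?_
      rintro _ ⟨w, hw, rfl⟩
      have hw : F B w = z := hw
      simp [← h, hw, hz]
    refine (hsum t).not_ge ?_
    calc s t = #(π '' (F A ⁻¹' {e (some t)})) := by rw [mk_image_eq π.injective, hsome A t ht]
      _ ≤ #(⋃ t' : {t' // s t' < s t}, {w | t'.1 ∈ B ∧ F B w = e (some t')}) := by
        refine mk_le_mk_of_subset ?_
        rintro _ ⟨x, hx, rfl⟩
        have hx : F A x = e (some t) := hx
        have hp : p (F B (π x)) = e (some t) := by rw [← hx, ← h]; rfl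
        rcases hF B (π x) with hy | ⟨t', ht', hy⟩
        · exact absurd (hlt t) (hnone B ▸ hle _ (hy ▸ hp)).not_gt
        · refine Set.mem_iUnion.2 ⟨⟨t', lt_of_le_of_ne ?_ fun hst => ?_⟩, ht', hy⟩
          · exact hsome B t' ht' ▸ hle _ (hy ▸ hp)
          · exact htB (hs hst ▸ ht')
      _ ≤ Cardinal.sum fun t' : {t' // s t' < s t} =>
          #{w | t'.1 ∈ B ∧ F B w = e (some t')} := mk_iUnion_le_sum_mk
      _ ≤ Cardinal.sum fun t' : {t' // s t' < s t} => s t' := by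
        refine sum_le_sum _ _ fun t' => ?_
        by_cases ht' : t'.1 ∈ B
        · exact (mk_le_mk_of_subset fun w hw => hw.2).trans (hsome B _ ht').le
        · simp [ht']


/-- The sets `separatingSet e Z` form an antichain. -/
def separatingSet {T : Type u} (e : T ≃ T × Bool) (Z : Set T) : Set T :=
  {t | (e t).2 = true ↔ (e t).1 ∈ Z}

theorem eq_of_separatingSet_subset {T : Type u} (e : T ≃ T × Bool) {Z W : Set T}
    (h : separatingSet e Z ⊆ separatingSet e W) : Z = W := by
  ext z
  by_cases hz : z ∈ Z
  · have := @h (e.symm (z, true)) (by simp [separatingSet, hz])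
    simpa [separatingSet, hz] using this
  · have := @h (e.symm (z, false)) (by simp [separatingSet, hz])
    simpa [separatingSet, hz] using this

theorem bijective_or_exists_of_mem_closure {X : Type u} {𝓕 : Set (Function.End X)}
    {w : Function.End X}
    (hw : w ∈ Submonoid.closure ((permSubmonoid X : Set (Function.End X)) ∪ 𝓕)) :
    Bijective w ∨ ∃ f ∈ 𝓕, ∃ (p : X → X) (π : Equiv.Perm X), p ∘ f ∘ π = w := by
  induction hw using Submonoid.closure_induction with
  | mem w hw => exact hw.imp id fun h => ⟨w, h, id, 1, rfl⟩
  | one => exact Or.inl bijective_id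
  | mul w₁ w₂ _ _ h₁ h₂ =>
    rcases h₂ with h₂ | ⟨f, hf, p, π, rfl⟩
    · rcases h₁ with h₁ | ⟨f, hf, p, π, rfl⟩
      · exact Or.inl (h₁.comp h₂)
      · exact Or.inr ⟨f, hf, p, (Equiv.ofBijective w₂ h₂).trans π, rfl⟩
    · exact Or.inr ⟨f, hf, w₁ ∘ p, π, rfl⟩

/-- The lower bound, given a family of cardinals each exceeding the sum of the smaller ones. -/
theorem two_power_le_mk_interval {X T : Type u} [Infinite X] [Infinite T]
    (hreg : (#X).IsRegular) {G : Submonoid (Function.End X)} (hG : Precomplete G)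
    (hS : permSubmonoid X ≤ G) (s : T → Cardinal.{u}) (hs : Injective s)
    (hT : #T ≤ #X) (hlt : ∀ t, s t < #X)
    (hsum : ∀ t, Cardinal.sum (fun t' : {t' // s t' < s t} => s t') < s t) :
    (2 : Cardinal.{u}) ^ ((2 : Cardinal.{u}) ^ #T) ≤
      #{M : Submonoid (Function.End X) // permSubmonoid X ≤ M ∧ M ≤ G} := by
  obtain ⟨F, hc, hd, hA, hsep⟩ := exists_family_of_sum_lt s hs hT hlt hsum
  obtain ⟨e⟩ : Nonempty (T ≃ T × Bool) := by
    refine Cardinal.lift_mk_eq'.1 ?_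
    have := mul_eq_left (aleph0_le_mk T) ((natCast_lt_aleph0 (n := 2)).le.trans (aleph0_le_mk T))
      (by norm_num)
    simpa using this.symm
  let 𝓕 : Set (Set T) → Set (Function.End X) := fun U => (fun Z => F (separatingSet e Z)) '' U
  let M : Set (Set T) → Submonoid (Function.End X) := fun U =>
    Submonoid.closure ((permSubmonoid X : Set (Function.End X)) ∪ 𝓕 U)
  have hM : ∀ U, permSubmonoid X ≤ M U ∧ M U ≤ G := by
    refine fun U => ⟨fun f hf => Submonoid.subset_closure (Or.inl hf),
      Submonoid.closure_le.2 (Set.union_subset hS ?_)⟩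
    rintro _ ⟨Z, -, rfl⟩
    exact hG.mem_of_mk_compl_range hreg hS (hc _) (hd _) (hA _)
  have hmem : ∀ U Z, F (separatingSet e Z) ∈ M U ↔ Z ∈ U := by
    refine fun U Z => ⟨fun h => ?_, fun h => Submonoid.subset_closure (Or.inr ⟨Z, h, rfl⟩)⟩
    rcases bijective_or_exists_of_mem_closure h with hb | ⟨_, ⟨W, hW, rfl⟩, p, π, hp⟩
    · have h0 := hc (separatingSet e Z)
      rw [hb.surjective.range_eq, Set.compl_univ, mk_eq_zero] at h0
      exact absurd h0.symm (mk_ne_zero X)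
    · rwa [eq_of_separatingSet_subset e (hsep _ _ p π hp)]
  rw [← mk_set, ← mk_set]
  refine mk_le_of_injective (f := fun U => ⟨M U, hM U⟩) fun U V h => ?_
  have h : M U = M V := congrArg Subtype.val h
  ext Z
  rw [← hmem U, h, hmem V]

theorem sum_lt_of_mul_lt {ι : Type u} {f : ι → Cardinal.{u}} {n m c : Cardinal.{u}}
    (hn : #ι ≤ n) (hm : ∀ i, f i ≤ m) (hc : n * m < c) : Cardinal.sum f < c :=
  calc Cardinal.sum f ≤ Cardinal.sum fun _ : ι => m := sum_le_sum _ _ hm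
    _ = #ι * m := sum_const' _ _
    _ ≤ n * m := mul_le_mul_left hn m
    _ < c := hc

/-- There are `max |α| ℵ₀` many cardinals below `ℵ_α` each exceeding the sum of the smaller
ones. -/
theorem exists_size_function {α : Ordinal.{u}} :
    ∃ (T : Type u) (s : T → Cardinal.{u}), #T = max α.card ℵ₀ ∧ Injective s ∧
      (∀ t, s t < aleph α) ∧
      ∀ t, Cardinal.sum (fun t' : {t' // s t' < s t} => s t') < s t := by
  rcases le_total α.card ℵ₀ with hα | hα
  · have hmono : StrictMono fun i : ℕ => (i + 1).factorial := fun i j hij =>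
      (Nat.factorial_lt i.succ_pos).2 (Nat.succ_lt_succ hij)
    refine ⟨ULift ℕ, fun i => ((i.down + 1).factorial : Cardinal), ?_, ?_, fun i => ?_,
      fun i => ?_⟩
    · simp [hα]
    · exact fun i j h => ULift.down_injective (hmono.injective (Nat.cast_injective h))
    · exact natCast_lt_aleph0.trans_le (aleph0_le_aleph α)
    · refine sum_lt_of_mul_lt (n := (i.down : Cardinal)) (m := (i.down.factorial : Cardinal))
        ?_ (fun j => ?_) ?_
      · have : (i.down : Cardinal.{u}) = #(ULift.{u} (Fin i.down)) := by simp
        rw [this]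
        exact mk_le_of_injective
          (f := fun j => ⟨⟨j.1.down, hmono.lt_iff_lt.1 (Nat.cast_lt.1 j.2)⟩⟩) fun j k h =>
            Subtype.ext (ULift.ext _ _ (Fin.val_eq_of_eq (ULift.up_injective h)))
      · exact Nat.cast_le.2 (Nat.factorial_le (hmono.lt_iff_lt.1 (Nat.cast_lt.1 j.2)))
      · rw [← Nat.cast_mul, Nat.cast_lt, Nat.factorial_succ]
        exact Nat.mul_lt_mul_of_pos_right (Nat.lt_succ_self _) (Nat.factorial_pos _)
  · let o : α.ToType → Ordinal.{u} := Ordinal.typein (· < ·)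
    have ho : Injective o := Ordinal.typein_injective _
    have : Infinite α.ToType := infinite_iff.2 ((mk_toType α).symm ▸ hα)
    refine ⟨({t | o t + 1 = α}ᶜ : Set α.ToType), fun t => aleph (o t + 1), ?_,
      fun t t' h => ?_, fun t => ?_, fun t => ?_⟩
    · rw [max_eq_left hα, ← mk_toType, mk_compl_of_infinite]
      refine lt_of_le_of_lt (mk_le_one_iff_set_subsingleton.2 fun x hx y hy => ?_)
        (one_lt_aleph0.trans_le (aleph0_le_mk _))
      exact ho (Order.succ_injective (hx.trans hy.symm))
    · exact Subtype.ext (ho (Order.succ_injective (aleph.injective h)))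
    · exact aleph_lt_aleph.2 (lt_of_le_of_ne
        (Order.add_one_le_of_lt (Ordinal.typein_lt_self t.1)) t.2)
    · have hlt : ∀ {t' : α.ToType}, aleph (o t' + 1) < aleph (o t + 1) → o t' < o t :=
        fun h => Order.succ_lt_succ_iff.1 (aleph_lt_aleph.1 h)
      refine sum_lt_of_mul_lt (n := aleph (o t)) (m := aleph (o t)) ?_ (fun j => ?_) ?_
      · refine le_trans ?_ (Ordinal.card_le_aleph (o t))
        rw [Ordinal.card_typein]
        exact mk_le_of_injective
          (f := fun j => ⟨j.1.1, (Ordinal.typein_lt_typein _).1 (hlt j.2)⟩) fun j k h =>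
            Subtype.ext (Subtype.ext (Subtype.mk.inj h))
      · exact aleph_le_aleph.2 (Order.add_one_le_of_lt (hlt j.2))
      · rw [mul_eq_self (aleph0_le_aleph _)]
        exact aleph_lt_aleph.2 (Order.lt_succ _)

end LowerBound

section UpperBound

variable {X : Type u}

/-- Functions with the same number of fibers of every cardinality are equal up to permutations
of domain and codomain. -/
theorem exists_perm_comp_comp_eq {f g : X → X}
    (h : ∀ η : Cardinal.{u}, #{y | #(f ⁻¹' {y}) = η} = #{y | #(g ⁻¹' {y}) = η}) :
    ∃ π σ : Equiv.Perm X, π ∘ f ∘ σ = g := by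
  have e : ∀ η : Cardinal.{u}, {y // #(f ⁻¹' {y}) = η} ≃ {y // #(g ⁻¹' {y}) = η} :=
    fun η => (Cardinal.eq.1 (h η)).some
  let π : Equiv.Perm X := (Equiv.sigmaFiberEquiv fun y => #(f ⁻¹' {y})).symm.trans
    ((Equiv.sigmaCongrRight e).trans (Equiv.sigmaFiberEquiv fun y => #(g ⁻¹' {y})))
  have hπ : ∀ y, #(g ⁻¹' {π y}) = #(f ⁻¹' {y}) := fun y => (e _ ⟨y, rfl⟩).2
  have d : ∀ y, {x // f x = y} ≃ {x // g x = π y} := fun y => (Cardinal.eq.1 (hπ y).symm).some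
  let σ : Equiv.Perm X := (Equiv.sigmaFiberEquiv f).symm.trans
    ((Equiv.sigmaCongr π d).trans (Equiv.sigmaFiberEquiv g))
  have hσ : ∀ x, g (σ x) = π (f x) := fun x => (d _ ⟨x, rfl⟩).2
  refine ⟨π, σ.symm, funext fun x => ?_⟩
  change π (f (σ.symm x)) = g x
  rw [← hσ, Equiv.apply_symm_apply]

theorem exists_card_code {α : Ordinal.{u}} :
    ∃ (J : Type u) (c : J → Cardinal.{u}), #J ≤ max α.card ℵ₀ ∧
      ∀ η ≤ aleph α, ∃ j, c j = η := by
  refine ⟨ULift ℕ ⊕ (α + 1).ToType,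
    Sum.elim (fun n => (n.down : Cardinal)) (fun o => aleph (Ordinal.ToType.toOrd o)),
    ?_, fun η hη => ?_⟩
  · rw [mk_sum, lift_id, lift_id, mk_toType, Ordinal.card_add_one]
    have h := le_max_right α.card ℵ₀
    refine add_le_of_le h ?_ (add_le_of_le h (le_max_left _ _) (one_le_aleph0.trans h))
    simp
  · rcases lt_or_ge η ℵ₀ with h | h
    · obtain ⟨n, rfl⟩ := lt_aleph0.1 h
      exact ⟨Sum.inl ⟨n⟩, rfl⟩
    · obtain ⟨o, rfl⟩ := mem_range_aleph_iff.2 h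
      exact ⟨Sum.inr (Ordinal.ToType.mk ⟨o, Order.lt_succ_of_le (aleph_le_aleph.1 hη)⟩), by simp⟩

/-- The upper bound: a submonoid containing the permutations is determined by the fiber counts of
its elements. -/
theorem mk_interval_le_two_power {J : Type u} {c : J → Cardinal.{u}}
    (hc : ∀ η ≤ #X, ∃ j, c j = η) (G : Submonoid (Function.End X)) :
    #{M : Submonoid (Function.End X) // permSubmonoid X ≤ M ∧ M ≤ G} ≤
      (2 : Cardinal.{u}) ^ (#J ^ #J) := by
  have : Nonempty J := ⟨(hc 0 zero_le).choose⟩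
  choose! code hcode using hc
  let k : Function.End X → J → J := fun f j => code #{y | #(f ⁻¹' {y}) = c j}
  have hk : ∀ f g, k f = k g → ∃ π σ : Equiv.Perm X, π ∘ f ∘ σ = g := by
    refine fun f g h => exists_perm_comp_comp_eq fun η => ?_
    by_cases hη : η ≤ #X
    · rw [← hcode η hη, ← hcode _ (mk_set_le {y | #(f ⁻¹' {y}) = c (code η)}),
        ← hcode _ (mk_set_le {y | #(g ⁻¹' {y}) = c (code η)})]
      exact congrArg c (congrFun h (code η))
    · have : ∀ w : Function.End X, {y | #(w ⁻¹' {y}) = η} = ∅ := fun w =>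
        Set.eq_empty_of_forall_notMem fun y hy => hη (hy ▸ mk_set_le _)
      rw [this, this]
  have hle : ∀ M N : Submonoid (Function.End X), permSubmonoid X ≤ N →
      k '' M = k '' N → M ≤ N := by
    intro M N hN h f hf
    obtain ⟨g, hg, hgf⟩ : k f ∈ k '' N := h ▸ Set.mem_image_of_mem k hf
    obtain ⟨π, σ, rfl⟩ := hk g f hgf
    exact comp_mem (mem_of_perm hN π) (comp_mem hg (mem_of_perm hN σ))
  rw [power_def, ← mk_set]
  refine mk_le_of_injective (f := fun M => k '' M.1) fun M N h => Subtype.ext ?_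
  exact le_antisymm (hle _ _ N.2.1 h) (hle _ _ M.2.1 h.symm)

end UpperBound

/-- On an infinite set of regular cardinality `κ = ℵ_α`, for every precomplete submonoid `G`
of the full transformation monoid containing the permutations, the interval `[S, G]` has
cardinality `2^(2^λ)`, where `λ = max(|α|, ℵ₀)`. -/
theorem card_interval_S_precomplete_regular {X : Type u} [Infinite X] {α : Ordinal.{u}}
    (hκ : #X = Cardinal.aleph α) (hreg : (Cardinal.aleph α).IsRegular)
    (lam : Cardinal.{u}) (hlam : lam = max α.card ℵ₀)
    (G : Submonoid (Function.End X)) (hG : Precomplete G) (hSG : permSubmonoid X ≤ G) :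
    #{M : Submonoid (Function.End X) // permSubmonoid X ≤ M ∧ M ≤ G} =
      (2 : Cardinal.{u}) ^ ((2 : Cardinal.{u}) ^ lam) := by
  subst hlam
  have hreg' : (#X).IsRegular := hκ ▸ hreg
  apply le_antisymm
  · obtain ⟨J, c, hJ, hc⟩ := exists_card_code (α := α)
    have hω : ℵ₀ ≤ max α.card ℵ₀ := le_max_right _ _
    have h2 : (2 : Cardinal.{u}) ≠ 0 := two_ne_zero
    refine (mk_interval_le_two_power (hκ ▸ hc) G).trans (power_le_power_left h2 ?_)
    rw [← power_self_eq hω]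
    exact (power_le_power_right hJ).trans (power_le_power_left (aleph0_pos.trans_le hω).ne' hJ)
  · obtain ⟨T, s, hT, hs, hlt, hsum⟩ := exists_size_function (α := α)
    have : Infinite T := infinite_iff.2 (hT ▸ le_max_right _ _)
    rw [← hT]
    refine two_power_le_mk_interval hreg' hG hSG s hs ?_ (fun t => hκ ▸ hlt t) hsum
    rw [hT, hκ]
    exact max_le (Ordinal.card_le_aleph α) (aleph0_le_aleph α)
end

section
/- Let X be an infinite set of regular cardinality κ = ℵ_α, let λ = max(|α|, ℵ₀), and let D be the intersection of all precomplete submonoids of O^(1) that contain the permutations. Then there is an order embedding of the power set of 2^λ (ordered by inclusion) into the interval [S, D] of submonoids of O^(1) (ordered by inclusion); in particular |[S, D]| = 2^(2^λ). -/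
open Cardinal

universe u

section Fibers

/-- Two maps whose fibers are pairwise equinumerous differ by a bijection of their domains. -/
theorem exists_equiv_of_mk_fiber_eq {X Y : Type u} {Z : Type*} {p : X → Z} {q : Y → Z}
    (h : ∀ z, #{x // p x = z} = #{y // q y = z}) : ∃ e : X ≃ Y, ∀ x, q (e x) = p x := by
  have h' : ∀ z, Nonempty ({x // p x = z} ≃ {y // q y = z}) := fun z => Cardinal.eq.1 (h z)
  exact ⟨Equiv.ofFiberEquiv fun z => (h' z).some, fun x => Equiv.ofFiberEquiv_map _ x⟩

/-- A map with prescribed fiber cardinalities exists as soon as they add up correctly. -/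
theorem exists_mk_fiber_eq {X O : Type u} {w : O → Cardinal.{u}} (hw : Cardinal.sum w = #X) :
    ∃ g : X → O, ∀ o, #{x // g x = o} = w o := by
  have hX : #X = #(Σ o, (w o).out) := by rw [← hw, mk_sigma]; simp
  obtain ⟨e⟩ := Cardinal.eq.1 hX
  refine ⟨fun x => (e x).1, fun o => ?_⟩
  have e₁ : {x // (e x).1 = o} ≃ {y : Σ o, (w o).out // y.1 = o} :=
    e.subtypeEquiv fun x => Iff.rfl
  have e₂ : {y : Σ o, (w o).out // y.1 = o} ≃ (w o).out := Equiv.sigmaSubtype o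
  rw [mk_congr (e₁.trans e₂), mk_out]

end Fibers

/-- An injection into `X` whose range has a complement of full cardinality. -/
structure MoietyInjective {A X : Type u} (s : A → X) : Prop where
  injective : Function.Injective s
  mk_compl : #((Set.range s)ᶜ : Set X) = #X

namespace MoietyInjective

variable {A B X : Type u}

theorem comp_injective {Y : Type u} {s : A → X} {t : X → Y} (hs : MoietyInjective s)
    (ht : Function.Injective t) (hXY : #Y = #X) : MoietyInjective (t ∘ s) := by
  refine ⟨ht.comp hs.injective, (mk_set_le _).antisymm ?_⟩
  rw [hXY, ← hs.mk_compl]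
  refine mk_le_of_injective (f := fun y => ⟨t y.1, ?_⟩) ?_
  · rintro ⟨a, ha⟩
    exact y.2 ⟨a, ht ha⟩
  · intro y z h
    exact Subtype.ext (ht (congrArg Subtype.val h))

theorem comp_left {s : A → X} {t : B → A} (hs : MoietyInjective s)
    (ht : Function.Injective t) : MoietyInjective (s ∘ t) := by
  refine ⟨hs.injective.comp ht, (mk_set_le _).antisymm ?_⟩
  rw [← hs.mk_compl]
  exact mk_le_mk_of_subset (Set.compl_subset_compl.2 (Set.range_comp_subset_range t s))

theorem exists_self (X : Type u) [Infinite X] : ∃ s : X → X, MoietyInjective s := by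
  have h : #(X ⊕ X) = #X := by simp
  obtain ⟨e⟩ := Cardinal.eq.1 h
  refine ⟨fun x => e (Sum.inl x), e.injective.comp Sum.inl_injective,
    (mk_set_le _).antisymm (mk_le_of_injective (f := fun x => ⟨e (Sum.inr x), ?_⟩) ?_)⟩
  · simp
  · intro x y h
    simpa using h

/-- Two injections onto moieties differ by a permutation of the codomain. -/
theorem exists_perm {s t : A → X} (hs : MoietyInjective s) (ht : MoietyInjective t) :
    ∃ e : Equiv.Perm X, ∀ a, e (s a) = t a := by
  classical
  obtain ⟨c⟩ := Cardinal.eq.1 (hs.mk_compl.trans ht.mk_compl.symm)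
  let r := (Equiv.ofInjective s hs.injective).symm.trans (Equiv.ofInjective t ht.injective)
  refine ⟨(Equiv.Set.sumCompl _).symm.trans ((Equiv.sumCongr r c).trans
    (Equiv.Set.sumCompl _)), fun a => ?_⟩
  have h : (Equiv.Set.sumCompl (Set.range s)).symm (s a) = Sum.inl ⟨s a, a, rfl⟩ :=
    Equiv.Set.sumCompl_symm_apply_of_mem (Set.mem_range_self a)
  simp only [Equiv.trans_apply, h, Equiv.sumCongr_apply, Sum.map_inl,
    Equiv.Set.sumCompl_apply_inl, r]
  rw [show (⟨s a, a, rfl⟩ : Set.range s) = Equiv.ofInjective s hs.injective a from rfl,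
    Equiv.symm_apply_apply]
  rfl

end MoietyInjective

section Frattini

variable {X : Type u}

/-- On a set of regular cardinality, functions with few large fibers form a submonoid. -/
def fewLargeFibers (X : Type u) (hX : (#X).IsRegular) : Submonoid (Function.End X) where
  carrier := monA X
  one_mem' := by
    have : IsEmpty {y : X | ¬ #((1 : Function.End X) ⁻¹' {y}) < #X} := by
      refine ⟨fun y => y.2 ?_⟩
      rw [show ((1 : Function.End X) ⁻¹' {y.1}) = {y.1} from rfl, mk_singleton]
      exact one_lt_aleph0.trans_le hX.aleph0_le
    exact (mk_eq_zero _).trans_lt hX.pos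
  mul_mem' := by
    intro f g hf hg
    have hsub : {y : X | ¬ #((f * g : Function.End X) ⁻¹' {y}) < #X} ⊆
        {y : X | ¬ #(f ⁻¹' {y}) < #X} ∪ f '' {y : X | ¬ #(g ⁻¹' {y}) < #X} := by
      intro y hy
      by_contra hcon
      rw [Set.mem_union, not_or] at hcon
      apply hy
      have : ((f * g : Function.End X) ⁻¹' {y}) = ⋃ x : f ⁻¹' {y}, g ⁻¹' {x.1} := by
        ext z
        rw [Set.mem_iUnion]
        exact ⟨fun hz => ⟨⟨g z, hz⟩, rfl⟩, fun ⟨x, hx⟩ => (congrArg f hx).trans x.2⟩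
      rw [this, card_iUnion_lt_iff_forall_of_isRegular hX (not_not.1 hcon.1)]
      intro x
      by_contra hx
      exact hcon.2 ⟨x, hx, x.2⟩
    refine (mk_le_mk_of_subset hsub).trans_lt ((mk_union_le _ _).trans_lt ?_)
    exact add_lt_of_lt hX.aleph0_le hf (mk_image_le.trans_lt hg)

/-- If every element of `P` and `f` either stabilizes the right multiples staying in `P` or
destroys a property that no right factor can restore, then so does every element generated. -/
theorem mul_mem_or_of_closure_eq_top {M : Type*} [Monoid M] {P : Submonoid M} {f : M}
    {J Q : Set M} (hJ1 : (1 : M) ∈ J) (hP : ∀ p ∈ P, ∀ k ∈ J, p * k ∈ J ∨ p * k ∈ Q)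
    (hf : ∀ k ∈ J, f * k ∈ J ∨ f * k ∈ Q) (hQ : ∀ a, ∀ b ∈ Q, a * b ∈ Q)
    (htop : Submonoid.closure ((P : Set M) ∪ {f}) = ⊤) (h : M) : h ∈ J ∨ h ∈ Q := by
  let N : Submonoid M :=
    { carrier := {h | ∀ k ∈ J, h * k ∈ J ∨ h * k ∈ Q}
      one_mem' := fun k hk => by simp [hk]
      mul_mem' := fun {a b} ha hb k hk => by
        rcases hb k hk with h | h
        · rw [mul_assoc]; exact ha _ h
        · rw [mul_assoc]; exact Or.inr (hQ _ _ h) }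
  have hN : Submonoid.closure ((P : Set M) ∪ {f}) ≤ N := by
    rw [Submonoid.closure_le]
    rintro p (hp | rfl)
    · exact hP p hp
    · exact hf
  rw [htop] at hN
  simpa using hN (Submonoid.mem_top h) 1 hJ1

/-- Left-right dual of `mul_mem_or_of_closure_eq_top`. -/
theorem mul_mem_or_of_closure_eq_top' {M : Type*} [Monoid M] {P : Submonoid M} {f : M}
    {J Q : Set M} (hJ1 : (1 : M) ∈ J) (hP : ∀ p ∈ P, ∀ k ∈ J, k * p ∈ J ∨ k * p ∈ Q)
    (hf : ∀ k ∈ J, k * f ∈ J ∨ k * f ∈ Q) (hQ : ∀ a, ∀ b ∈ Q, b * a ∈ Q)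
    (htop : Submonoid.closure ((P : Set M) ∪ {f}) = ⊤) (h : M) : h ∈ J ∨ h ∈ Q := by
  let N : Submonoid M :=
    { carrier := {h | ∀ k ∈ J, k * h ∈ J ∨ k * h ∈ Q}
      one_mem' := fun k hk => by simp [hk]
      mul_mem' := fun {a b} ha hb k hk => by
        rcases ha k hk with h | h
        · rw [← mul_assoc]; exact hb _ h
        · rw [← mul_assoc]; exact Or.inr (hQ _ _ h) }
  have hN : Submonoid.closure ((P : Set M) ∪ {f}) ≤ N := by
    rw [Submonoid.closure_le]
    rintro p (hp | rfl)
    · exact hP p hp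
    · exact hf
  rw [htop] at hN
  simpa using hN (Submonoid.mem_top h) 1 hJ1

variable {P : Submonoid (Function.End X)} {f : Function.End X}

/-- If `f` is not injective on any set with small complement, then it cannot help `P` in
generating an injection onto a moiety. -/
theorem exists_moietyInjective_mem [Infinite X] (hfi : ¬ XiInjective #X f)
    (htop : Submonoid.closure ((P : Set (Function.End X)) ∪ {f}) = ⊤) :
    ∃ c ∈ P, MoietyInjective c := by
  by_contra! hcon
  obtain ⟨u, hu⟩ := MoietyInjective.exists_self X
  have key := mul_mem_or_of_closure_eq_top (P := P) (f := f)
    (J := {k | k ∈ P ∧ Function.Injective k}) (Q := {k | ¬ Function.Injective k})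
    ⟨P.one_mem, Function.injective_id⟩
    (fun p hp k hk => by
      by_cases h : Function.Injective (p * k)
      · exact Or.inl ⟨P.mul_mem hp hk.1, h⟩
      · exact Or.inr h)
    (fun k hk => by
      refine Or.inr fun h => hfi ⟨(Set.range k)ᶜ, ?_, ?_⟩
      · refine lt_of_le_of_ne (mk_set_le _) fun heq => hcon k hk.1 ⟨hk.2, heq⟩
      · rw [compl_compl]
        rintro _ ⟨a, rfl⟩ _ ⟨b, rfl⟩ hab
        exact congrArg k (h hab))
    (fun a b hb h => hb (Function.Injective.of_comp (f := a) h)) htop u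
  rcases key with h | h
  · exact hcon u h.1 hu
  · exact h hu.injective

/-- If `f` misses a moiety, then it cannot help `P` in generating a surjection from a moiety. -/
theorem exists_section_mem [Infinite X] (hfs : ¬ XiSurjective #X f)
    (htop : Submonoid.closure ((P : Set (Function.End X)) ∪ {f}) = ⊤) :
    ∃ c ∈ P, ∃ s : X → X, MoietyInjective s ∧ ∀ x, c (s x) = x := by
  by_contra! hcon
  obtain ⟨u, hu⟩ := MoietyInjective.exists_self X
  have key := mul_mem_or_of_closure_eq_top' (P := P) (f := f)
    (J := {k | k ∈ P}) (Q := {k | ¬ Function.Surjective k}) P.one_mem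
    (fun p hp k hk => Or.inl (P.mul_mem hk hp))
    (fun k hk => by
      refine Or.inr fun h => ?_
      have hr : ∀ x, k (f (Function.surjInv h x)) = x := Function.surjInv_eq h
      obtain ⟨x, hx⟩ := hcon k hk (fun x => f (Function.surjInv h x))
        ⟨Function.LeftInverse.injective (g := k) hr, (mk_set_le _).antisymm ((not_lt.1 hfs).trans
          (mk_le_mk_of_subset (Set.compl_subset_compl.2 (Set.range_comp_subset_range _ f))))⟩
      exact hx (hr x))
    (fun a b hb h => hb (Function.Surjective.of_comp (g := a) h)) htop (Function.invFun u)
  rcases key with h | h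
  · obtain ⟨x, hx⟩ := hcon _ h u hu
    exact hx (Function.leftInverse_invFun hu.injective x)
  · exact h (Function.invFun_surjective hu.injective)

/-- If `c` has many large fibers, then all functions are right multiples of `c` by injections onto
moieties, up to an injection on the left. -/
theorem exists_mul_eq_of_notMem_monA [Infinite X] {c : Function.End X} (hc : c ∉ monA X) :
    ∃ e : X → X, MoietyInjective e ∧
      ∀ h : X → X, ∃ k : X → X, MoietyInjective k ∧ ∀ x, c (k x) = e (h x) := by
  obtain ⟨u, hu⟩ := MoietyInjective.exists_self X
  have hZ : #X = #{y : X | ¬ #(c ⁻¹' {y}) < #X} :=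
    (not_lt.1 (show ¬ _ < _ from hc)).antisymm (mk_set_le _)
  obtain ⟨b⟩ := Cardinal.eq.1 hZ
  have hφ : ∀ x, Nonempty (X ≃ (c ⁻¹' {(b x).1})) := fun x =>
    Cardinal.eq.1 ((not_lt.1 (b x).2).antisymm (mk_set_le _))
  let φ := fun x => (hφ x).some
  have hcφ : ∀ x y, c (φ x y) = b x := fun x y => (φ x y).2
  have hbi : Function.Injective fun x => (b x : X) := Subtype.val_injective.comp b.injective
  have hφi : ∀ x x' y y', (φ x y : X) = φ x' y' → y = y' := by
    intro x x' y y' h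
    have hx : x = x' := hbi (by simpa only [hcφ] using congrArg c h)
    subst hx
    exact (φ x).injective (Subtype.ext h)
  refine ⟨fun x => b (u x), hu.comp_injective hbi rfl, fun h =>
    ⟨fun x => φ (u (h x)) (u x), ⟨?_, (mk_set_le _).antisymm ?_⟩, fun x => hcφ _ _⟩⟩
  · intro x y hxy
    exact hu.injective (hφi _ _ _ _ hxy)
  · let x₀ : X := Classical.arbitrary X
    conv_lhs => rw [← hu.mk_compl]
    refine mk_le_of_injective (f := fun y => ⟨φ x₀ y.1, ?_⟩) ?_
    · rintro ⟨x, hx⟩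
      exact y.2 ⟨x, hφi _ _ _ _ hx⟩
    · intro y z h
      exact Subtype.ext (hφi x₀ x₀ _ _ (by simpa using h))

/-- A function on a set of regular cardinality with few large fibers which misses a moiety and is
not injective on any set with small complement belongs to all precomplete monoids containing the
permutations. -/
theorem mem_of_precomplete [Infinite X] (hX : (#X).IsRegular) (hP : Precomplete P)
    (hS : permSubmonoid X ≤ P) (hfA : f ∈ monA X) (hfi : ¬ XiInjective #X f)
    (hfs : ¬ XiSurjective #X f) : f ∈ P := by
  by_contra hfP
  have htop := hP.2 f hfP
  have hperm : ∀ e : Equiv.Perm X, (e : X → X) ∈ P := fun e => hS e.bijective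
  obtain ⟨i, hiP, hi⟩ := exists_moietyInjective_mem hfi htop
  obtain ⟨d, hdP, s, hs, hds⟩ := exists_section_mem hfs htop
  obtain ⟨c, hcP, hc⟩ : ∃ c ∈ P, c ∉ monA X := by
    by_contra! hcon
    have hle : Submonoid.closure ((P : Set (Function.End X)) ∪ {f}) ≤ fewLargeFibers X hX := by
      rw [Submonoid.closure_le]
      rintro p (hp | rfl)
      · exact hcon p hp
      · exact hfA
    obtain ⟨p⟩ := Cardinal.eq.1 (show #X = #(X × X) by simp)
    have hmem : (fun x => (p x).1) ∈ monA X := hle (htop ▸ Submonoid.mem_top _)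
    refine lt_irrefl #X (lt_of_le_of_lt ?_ hmem)
    refine mk_le_of_injective (f := fun y => ⟨y, not_lt.2 ?_⟩) fun _ _ h => congrArg Subtype.val h
    refine mk_le_of_injective (f := fun z => ⟨p.symm (y, z), by simp⟩) fun _ _ h => ?_
    simpa using congrArg Subtype.val h
  obtain ⟨e, he, hce⟩ := exists_mul_eq_of_notMem_monA hc
  obtain ⟨π, hπ⟩ := he.exists_perm hs
  refine hP.1 (eq_top_iff.2 fun h _ => ?_)
  obtain ⟨k, hk, hck⟩ := hce h
  obtain ⟨ρ, hρ⟩ := hi.exists_perm hk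
  let π' : Function.End X := ⇑π
  let ρ' : Function.End X := ⇑ρ
  have : h = d * π' * c * ρ' * i := by
    funext x
    change h x = d (π (c (ρ (i x))))
    rw [hρ, hck, hπ, hds]
  rw [this]
  exact P.mul_mem (P.mul_mem (P.mul_mem (P.mul_mem hdP (hperm π)) hcP) (hperm ρ)) hiP

end Frattini

section Counting

/-- Functions whose fibers realize every cardinality equally often differ by permutations on both
sides. -/
theorem exists_perm_conj {X : Type u} {f g : X → X}
    (h : ∀ ξ : Cardinal.{u}, #{y : X // #{x // f x = y} = ξ} = #{y : X // #{x // g x = y} = ξ}) :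
    ∃ π σ : Equiv.Perm X, ∀ x, f x = π (g (σ x)) := by
  obtain ⟨π, hπ⟩ := exists_equiv_of_mk_fiber_eq h
  obtain ⟨σ, hσ⟩ := exists_equiv_of_mk_fiber_eq (p := f) (q := fun x => π.symm (g x)) (by
    intro y
    simp only [Equiv.symm_apply_eq]
    exact (hπ y).symm)
  exact ⟨π.symm, σ, fun x => (hσ x).symm⟩

/-- The number of submonoids containing the permutations, bounded in terms of the number of
cardinals not exceeding that of the base set. -/
theorem mk_submonoid_le {X : Type u} [Infinite X] {K : Type u} (κ : Set.Iic (#X) → K)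
    (hκ : Function.Injective κ) (D : Submonoid (Function.End X)) :
    #{M : Submonoid (Function.End X) // permSubmonoid X ≤ M ∧ M ≤ D} ≤ #(Set (K → K)) := by
  let fib : (X → X) → X → Set.Iic (#X) := fun f y => ⟨#{x // f x = y}, mk_subtype_le _⟩
  let inv : (X → X) → K → K := fun f k =>
    κ ⟨#{y : X // κ (fib f y) = k}, mk_subtype_le _⟩
  have hinv : ∀ f g, inv f = inv g → ∃ π σ : Equiv.Perm X, ∀ x, f x = π (g (σ x)) := by
    intro f g hfg
    refine exists_perm_conj fun ξ => ?_
    by_cases hξ : ξ ≤ #X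
    · have := congrArg Subtype.val (hκ (congrFun hfg (κ ⟨ξ, hξ⟩)))
      simpa only [hκ.eq_iff, fib, Subtype.ext_iff] using this
    · have hE : ∀ f : X → X, #{y : X // #{x // f x = y} = ξ} = 0 := fun f => by
        rw [mk_eq_zero_iff]
        exact ⟨fun y => hξ (y.2 ▸ mk_subtype_le _)⟩
      rw [hE, hE]
  refine mk_le_of_injective
    (f := fun M => (inv '' {f : X → X | (f : Function.End X) ∈ M.1} : Set (K → K))) ?_
  have hsub : ∀ M N : {M : Submonoid (Function.End X) // permSubmonoid X ≤ M ∧ M ≤ D},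
      inv '' {f : X → X | (f : Function.End X) ∈ M.1} ⊆
        inv '' {f : X → X | (f : Function.End X) ∈ N.1} → M.1 ≤ N.1 := by
    intro M N hMN (f : Function.End X) hf
    obtain ⟨(g : Function.End X), hg, hgf⟩ := hMN ⟨f, hf, rfl⟩
    obtain ⟨π, σ, h⟩ := hinv f g hgf.symm
    let π' : Function.End X := ⇑π
    let σ' : Function.End X := ⇑σ
    have : f = π' * g * σ' := funext h
    rw [this]
    exact N.1.mul_mem (N.1.mul_mem (N.2.1 π.bijective) hg) (N.2.1 σ.bijective)
  intro M N hMN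
  exact Subtype.ext ((hsub M N hMN.subset).antisymm (hsub N M hMN.superset))

/-- There are `max |α| ℵ₀` cardinals up to `ℵ_α`. -/
theorem mk_Iic_aleph (α : Ordinal.{u}) :
    #(Set.Iic (ℵ_ α)) = Cardinal.lift.{u + 1} (max α.card ℵ₀) := by
  have e : Set.Iic (ℵ_ α) ≃ Set.Iio (Ordinal.omega0 + α + 1) :=
    preAleph.symm.toEquiv.subtypeEquiv fun c => by
      change c ≤ ℵ_ α ↔ preAleph.symm c < Ordinal.omega0 + α + 1
      rw [aleph_eq_preAleph, ← preAleph.symm_apply_le, Order.lt_add_one_iff]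
  have h : ℵ₀ ≤ max ℵ₀ α.card := le_max_left _ _
  rw [mk_congr e, mk_Iio_ordinal, Ordinal.card_add, Ordinal.card_add, Ordinal.card_omega0,
    Ordinal.card_one, add_eq_max le_rfl, add_eq_left h (one_le_aleph0.trans h), max_comm]

end Counting

section Sizes

/-- Reindexing a sum of cardinals along an injection does not increase it. -/
theorem sum_comp_le {A : Type u} {B : Type v} (w : B → Cardinal.{max u v}) {e : A → B}
    (he : Function.Injective e) :
    Cardinal.sum (fun a => w (e a)) ≤ Cardinal.sum w := by
  refine mk_le_of_injective (α := Σ a, (w (e a)).out) (β := Σ b, (w b).out)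
    (f := Sigma.map e fun _ => id) (he.sigma_map fun _ => Function.injective_id)

/-- Pairwise different cardinals such that none of them is reached by adding up smaller ones. -/
structure Superincreasing {ι : Type u} (ν : ι → Cardinal.{u}) : Prop where
  injective : Function.Injective ν
  sum_lt : ∀ i, Cardinal.sum (fun j : {j // ν j < ν i} => ν j) < ν i

theorem exists_superincreasing (α : Ordinal.{u}) :
    ∃ (ι : Type u) (ν : ι → Cardinal.{u}), #ι = max α.card ℵ₀ ∧ Superincreasing ν ∧
      ∀ i, ν i < ℵ_ α := by
  let J := {γ : α.ToType // (γ.toOrd : Ordinal.{u}) + 1 < α}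
  let ν : ℕ ⊕ J → Cardinal.{u} :=
    Sum.elim (fun n => ((2 ^ n : ℕ) : Cardinal.{u})) fun γ => ℵ_ ((γ.1.toOrd : Ordinal.{u}) + 1)
  have hlt : ∀ n γ, ν (Sum.inl n) < ν (Sum.inr γ) := fun n γ =>
    (natCast_lt_aleph0 (n := 2 ^ n)).trans_le (aleph0_le_aleph _)
  have hinj : Function.Injective ν := by
    rintro (m | γ) (n | δ) h
    · exact congrArg Sum.inl (Nat.pow_right_injective le_rfl (Nat.cast_injective h))
    · exact absurd h (hlt m δ).ne
    · exact absurd h (hlt n γ).ne'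
    · have h' : (γ.1.toOrd : Ordinal.{u}) = δ.1.toOrd := by simpa [ν] using h
      exact congrArg Sum.inr (Subtype.ext (Ordinal.ToType.mk.symm.injective (Subtype.ext h')))
  refine ⟨ℕ ⊕ J, ν, ?_, ⟨hinj, ?_⟩, ?_⟩
  · have hsub : #({γ : α.ToType | (γ.toOrd : Ordinal.{u}) + 1 < α}ᶜ : Set α.ToType) ≤ 1 := by
      rw [mk_le_one_iff_set_subsingleton]
      have : ∀ γ ∈ ({γ : α.ToType | (γ.toOrd : Ordinal.{u}) + 1 < α}ᶜ : Set α.ToType),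
          (γ.toOrd : Ordinal.{u}) + 1 = α := fun γ hγ =>
        (Order.add_one_le_of_lt γ.toOrd.2).antisymm (not_lt.1 hγ)
      intro γ hγ δ hδ
      have h : (γ.toOrd : Ordinal.{u}) + 1 = δ.toOrd + 1 := (this γ hγ).trans (this δ hδ).symm
      exact Ordinal.ToType.mk.symm.injective (Subtype.ext (by simpa using h))
    have hJ : #J ≤ α.card := (mk_subtype_le _).trans_eq (mk_toType α)
    have hα : α.card ≤ #J + 1 := by
      rw [← mk_toType, ← mk_sum_compl {γ : α.ToType | (γ.toOrd : Ordinal.{u}) + 1 < α}]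
      exact add_le_add le_rfl hsub
    rw [mk_sum, mk_nat, lift_aleph0, lift_id'.{0, u}, add_eq_max le_rfl]
    refine le_antisymm (max_le (le_max_right _ _) (hJ.trans (le_max_left _ _)))
      (max_le (hα.trans (add_le_of_le (le_max_left _ _) (le_max_right _ _)
        (one_le_aleph0.trans (le_max_left _ _)))) (le_max_left _ _))
  · rintro (n | γ)
    · have hj : ∀ j : {j // ν j < ν (Sum.inl n)}, ∃ m : Fin n, j.1 = Sum.inl m.1 := by
        rintro ⟨m | γ, h⟩
        · have h' : 2 ^ m < 2 ^ n := by
            simpa only [ν, Sum.elim_inl, Nat.cast_lt] using h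
          exact ⟨⟨m, (Nat.pow_lt_pow_iff_right one_lt_two).1 h'⟩, rfl⟩
        · exact absurd h (hlt n γ).not_gt
      choose e he using hj
      have hei : Function.Injective e := fun i j hij => Subtype.ext (by rw [he, he, hij])
      have hw : (fun j : {j // ν j < ν (Sum.inl n)} => ν j) =
          fun j => #(ULift.{u} (Fin (2 ^ (e j).1))) := by
        funext j
        rw [he]
        simp [ν]
      rw [hw]
      refine (sum_comp_le (fun m : Fin n => #(ULift.{u} (Fin (2 ^ m.1)))) hei).trans_lt ?_
      rw [← mk_sigma, mk_fintype]
      simp only [ν, Sum.elim_inl, Nat.cast_lt, Fintype.card_sigma, Fintype.card_ulift,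
        Fintype.card_fin]
      rw [Fin.sum_univ_eq_sum_range fun m => 2 ^ m]
      exact Nat.geomSum_lt le_rfl fun k hk => Finset.mem_range.1 hk
    · have hγ : ν (Sum.inr γ) = Order.succ (ℵ_ (γ.1.toOrd : Ordinal.{u})) := by
        simp only [ν, Sum.elim_inr, succ_aleph]
      have hle : ∀ j : {j // ν j < ν (Sum.inr γ)}, ν j ≤ ℵ_ (γ.1.toOrd : Ordinal.{u}) :=
        fun j => Order.lt_succ_iff.1 (j.2.trans_eq hγ)
      have hcard : #{j // ν j < ν (Sum.inr γ)} ≤ ℵ_ (γ.1.toOrd : Ordinal.{u}) := by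
        have := mk_le_of_injective (α := ULift.{u + 1} {j // ν j < ν (Sum.inr γ)})
          (f := fun j => (⟨ν j.down, hle j.down⟩ : Set.Iic (ℵ_ (γ.1.toOrd : Ordinal.{u}))))
          fun j k h => ULift.ext _ _ (Subtype.ext (hinj (congrArg Subtype.val h)))
        rw [mk_uLift, mk_Iic_aleph, lift_le] at this
        exact this.trans (max_le (Ordinal.card_le_aleph _) (aleph0_le_aleph _))
      refine lt_of_le_of_lt ?_ ((Order.lt_succ _).trans_eq hγ.symm)
      refine (sum_le_sum _ _ hle).trans ?_
      rw [sum_const']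
      exact mul_le_of_le (aleph0_le_aleph _) hcard le_rfl
  · rintro (n | γ)
    · exact (natCast_lt_aleph0 (n := 2 ^ n)).trans_le (aleph0_le_aleph _)
    · exact aleph_lt_aleph.2 γ.2

/-- Every infinite set carries an antichain of subsets indexed by all its subsets. -/
theorem exists_antichain (ι : Type u) [Infinite ι] :
    ∃ C : Set ι → Set ι, ∀ A B, C A ⊆ C B → A = B := by
  obtain ⟨e⟩ := Cardinal.eq.1 (show #(ι ⊕ ι) = #ι by simp)
  refine ⟨fun A => {i | Sum.elim (· ∈ A) (· ∉ A) (e.symm i)}, fun A B h => ?_⟩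
  ext i
  have h₁ := @h (e (Sum.inl i))
  have h₂ := @h (e (Sum.inr i))
  simp only [Set.mem_ofPred_eq, Equiv.symm_apply_apply, Sum.elim_inl, Sum.elim_inr] at h₁ h₂
  tauto

end Sizes

section Independence

variable {X ι : Type u} {ν : ι → Cardinal.{u}}

open Classical in
/-- The intended fiber cardinalities: one large fiber and one of size `ν i` for every `i ∈ C`. -/
noncomputable def fiberSize (X : Type u) (ν : ι → Cardinal.{u}) (C : Set ι) :
    Option ι → Cardinal.{u}
  | none => #X
  | some i => if i ∈ C then ν i else 0

theorem sum_fiberSize [Infinite X] (hι : #ι ≤ #X) (hν : ∀ i, ν i < #X) (C : Set ι) :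
    Cardinal.sum.{u, u} (fiberSize X ν C) = #X := by
  refine le_antisymm ?_ (le_sum.{u, u} (fiberSize X ν C) none)
  calc Cardinal.sum.{u, u} (fiberSize X ν C) ≤ Cardinal.sum.{u, u} (fun _ : Option ι => #X) := by
        refine sum_le_sum _ _ fun o => ?_
        cases o with
        | none => exact le_rfl
        | some i =>
          simp only [fiberSize]
          split_ifs
          · exact (hν i).le
          · exact zero_le
    _ ≤ #X := by
        rw [sum_const', mk_option]
        exact mul_le_of_le (aleph0_le_mk X) (add_le_of_le (aleph0_le_mk X) hι
          (one_le_aleph0.trans (aleph0_le_mk X))) le_rfl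

/-- If the partition into fibers of sizes `fiberSize X ν C` is coarser than one into fibers of sizes
`fiberSize X ν B`, then `C ⊆ B`. -/
theorem subset_of_coarser (hν : Superincreasing ν) (hνX : ∀ i, ν i < #X) {B C : Set ι}
    {g h : X → Option ι} (hg : ∀ o, #{x // g x = o} = fiberSize X ν C o)
    (hh : ∀ o, #{x // h x = o} = fiberSize X ν B o) (hgh : ∀ x y, h x = h y → g x = g y) :
    C ⊆ B := by
  intro i hiC
  by_contra hiB
  have hgi : #{x // g x = some i} = ν i := by rw [hg]; simp [fiberSize, hiC]
  have hcov : ∀ x, g x = some i → ∃ j, ν j < ν i ∧ h x = some j := by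
    intro x hx
    have hle : fiberSize X ν B (h x) ≤ ν i := by
      rw [← hh, ← hgi]
      exact mk_subtype_le_of_subset fun y hy => (hgh y x hy).trans hx
    have hpos : fiberSize X ν B (h x) ≠ 0 := by
      rw [← hh, mk_ne_zero_iff]
      exact ⟨x, rfl⟩
    cases hj : h x with
    | none =>
      rw [hj] at hle
      exact absurd (hνX i) (not_lt.2 hle)
    | some j =>
      rw [hj] at hle hpos
      have hjB : j ∈ B := by
        by_contra hjB
        exact hpos (by simp [fiberSize, hjB])
      refine ⟨j, lt_of_le_of_ne (by simpa [fiberSize, hjB] using hle) fun h => ?_, rfl⟩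
      exact hiB (hν.injective h ▸ hjB)
  refine lt_irrefl (ν i) (lt_of_le_of_lt ?_ (hν.sum_lt i))
  calc ν i = #{x // g x = some i} := hgi.symm
    _ ≤ #(⋃ j : {j // ν j < ν i}, {x | h x = some j.1} : Set X) := by
        refine mk_subtype_le_of_subset fun x hx => ?_
        obtain ⟨j, hj, hxj⟩ := hcov x hx
        exact Set.mem_iUnion.2 ⟨⟨j, hj⟩, hxj⟩
    _ ≤ Cardinal.sum fun j : {j // ν j < ν i} => #{x | h x = some j.1} := mk_iUnion_le_sum_mk
    _ ≤ Cardinal.sum fun j : {j // ν j < ν i} => ν j := by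
        refine sum_le_sum _ _ fun j => ?_
        change #{x // h x = some j.1} ≤ _
        rw [hh]
        simp only [fiberSize]
        split_ifs
        · exact le_rfl
        · exact zero_le

/-- The kernel of a non-permutation generated by the permutations and a set of functions is coarser
than that of a generator, up to a permutation. -/
theorem bijective_or_coarser_of_mem_closure {F : Set (Function.End X)} {h : Function.End X}
    (hh : h ∈ Submonoid.closure ((permSubmonoid X : Set (Function.End X)) ∪ F)) :
    Function.Bijective h ∨ ∃ f ∈ F, ∃ σ : Equiv.Perm X, ∀ x y, f (σ x) = f (σ y) → h x = h y := by
  induction hh using Submonoid.closure_induction_right with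
  | one => exact Or.inl Function.bijective_id
  | mul_right w hw y hy ih =>
    rcases hy with hy | hy
    · have hyb : Function.Bijective y := hy
      rcases ih with hb | ⟨f, hf, σ, hσ⟩
      · exact Or.inl (hb.comp hyb)
      · exact Or.inr ⟨f, hf, (Equiv.ofBijective y hyb).trans σ, fun a b hab => hσ _ _ hab⟩
    · exact Or.inr ⟨y, hy, Equiv.refl X, fun a b hab => congrArg w hab⟩

/-- For a regular cardinality of the base set, the intersection of the precomplete monoids above
the permutations contains a large family of functions none of which is generated by the others. -/
theorem exists_independent_family [Infinite X] (hX : (#X).IsRegular) [Infinite ι] (hι : #ι ≤ #X)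
    (hν : Superincreasing ν) (hνX : ∀ i, ν i < #X) :
    ∃ F : Set ι → Function.End X,
      (∀ A, F A ∈ sInf {C : Submonoid (Function.End X) | Precomplete C ∧ permSubmonoid X ≤ C}) ∧
      ∀ A (T : Set (Set ι)), F A ∈ Submonoid.closure
        ((permSubmonoid X : Set (Function.End X)) ∪ F '' T) → A ∈ T := by
  obtain ⟨C, hC⟩ := exists_antichain ι
  have hg := fun A => exists_mk_fiber_eq (sum_fiberSize (X := X) hι hνX (C A))
  choose g hg using hg
  obtain ⟨s, hs⟩ := MoietyInjective.exists_self X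
  have hO : #(Option ι) ≤ #X := by
    rw [mk_option]
    exact add_le_of_le (aleph0_le_mk X) hι (one_le_aleph0.trans (aleph0_le_mk X))
  obtain ⟨t⟩ := hO
  have hst := hs.comp_left t.injective
  let e : Option ι → X := s ∘ t
  have hlarge : ∀ A, #{x // g A x = none} = #X := fun A => hg A none
  let F : Set ι → Function.End X := fun A x => e (g A x)
  refine ⟨F, fun A => ?_, fun A T hAT => ?_⟩
  · rw [Submonoid.mem_sInf]
    rintro P ⟨hP, hS⟩
    refine mem_of_precomplete hX hP hS ?_ ?_ ?_
    · refine lt_of_le_of_lt ?_ (one_lt_aleph0.trans_le (aleph0_le_mk X))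
      rw [mk_le_one_iff_set_subsingleton]
      have : ∀ y ∈ {y : X | ¬ #(F A ⁻¹' {y}) < #X}, y = e none := by
        intro y hy
        by_contra hne
        apply hy
        by_cases hr : ∃ i, e (some i) = y
        · obtain ⟨i, rfl⟩ := hr
          have : (F A ⁻¹' {e (some i)}) = {x | g A x = some i} := by
            ext x
            exact hst.injective.eq_iff
          rw [this]
          change #{x // g A x = some i} < _
          rw [hg]
          simp only [fiberSize]
          split_ifs
          · exact hνX i
          · exact hX.pos
        · have : IsEmpty (F A ⁻¹' {y}) := by
            refine ⟨fun ⟨x, (hx : e (g A x) = y)⟩ => ?_⟩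
            cases ho : g A x with
            | none => exact hne (by rw [← hx, ho])
            | some i => exact hr ⟨i, by rw [← hx, ho]⟩
          rw [mk_eq_zero]
          exact hX.pos
      intro y hy z hz
      rw [this y hy, this z hz]
    · rintro ⟨Y, hY, hinj⟩
      have hsub : ({x | g A x = none} \ Y).Subsingleton := fun x hx y hy =>
        hinj hx.2 hy.2 (congrArg e (hx.1.trans hy.1.symm))
      have hle : #{x // g A x = none} ≤ #(({x | g A x = none} \ Y) ∪ Y : Set X) :=
        mk_subtype_le_of_subset fun x hx => by
          by_cases hxY : x ∈ Y
          · exact Or.inr hxY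
          · exact Or.inl ⟨hx, hxY⟩
      rw [hlarge] at hle
      refine lt_irrefl _ ((hle.trans (mk_union_le _ _)).trans_lt (add_lt_of_lt hX.aleph0_le ?_ hY))
      exact (mk_le_one_iff_set_subsingleton.2 hsub).trans_lt
        (one_lt_aleph0.trans_le hX.aleph0_le)
    · refine not_lt.2 (hst.mk_compl.symm.le.trans (mk_le_mk_of_subset ?_))
      exact Set.compl_subset_compl.2 (Set.range_comp_subset_range (g A) e)
  · rcases bijective_or_coarser_of_mem_closure hAT with hb | ⟨_, ⟨B, hB, rfl⟩, σ, hσ⟩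
    · have hsub : Subsingleton {x // g A x = none} :=
        ⟨fun x y => Subtype.ext (hb.1 (congrArg e (x.2.trans y.2.symm)))⟩
      have := le_one_iff_subsingleton.2 hsub
      rw [hlarge] at this
      exact absurd (this.trans_lt one_lt_aleph0) (not_lt.2 hX.aleph0_le)
    · have hsub : C A ⊆ C B := by
        refine subset_of_coarser hν hνX (hg A) (h := fun x => g B (σ x)) (fun o => ?_)
          fun x y hxy => hst.injective (hσ x y (congrArg e hxy))
        rw [← hg B]
        exact mk_congr (σ.subtypeEquiv fun x => Iff.rfl)
      rw [hC A B hsub]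
      exact hB

end Independence

/-- On an infinite set of regular cardinality `κ = ℵ_α`, with `D` the intersection of all
precomplete submonoids containing the permutations, the power set of `2^λ` order-embeds into
the interval `[S, D]`; in particular `|[S, D]| = 2^(2^λ)`, where `λ = max(|α|, ℵ₀)`. -/
theorem embedding_into_interval_S_D_regular {X : Type u} [Infinite X] {α : Ordinal.{u}}
    (hκ : #X = Cardinal.aleph α) (hreg : (Cardinal.aleph α).IsRegular)
    (lam : Cardinal.{u}) (hlam : lam = max α.card ℵ₀)
    (D : Submonoid (Function.End X))
    (hD : D = sInf {C : Submonoid (Function.End X) | Precomplete C ∧ permSubmonoid X ≤ C}) :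
    Nonempty (Set (Quotient.out ((2 : Cardinal.{u}) ^ lam)) ↪o
        {M : Submonoid (Function.End X) // permSubmonoid X ≤ M ∧ M ≤ D}) ∧
    #{M : Submonoid (Function.End X) // permSubmonoid X ≤ M ∧ M ≤ D} =
      (2 : Cardinal.{u}) ^ ((2 : Cardinal.{u}) ^ lam) := by
  obtain ⟨ι, ν, hι, hν, hνX⟩ := exists_superincreasing α
  rw [← hlam] at hι
  have hlam₀ : ℵ₀ ≤ lam := hlam ▸ le_max_right _ _
  have hlamX : lam ≤ #X := by
    rw [hlam, hκ]
    exact max_le (Ordinal.card_le_aleph α) (aleph0_le_aleph α)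
  have : Infinite ι := infinite_iff.2 (hι.symm ▸ hlam₀)
  rw [← hκ] at hreg hνX
  obtain ⟨F, hFD, hF⟩ := exists_independent_family hreg (hι.trans_le hlamX) hν hνX
  rw [← hD] at hFD
  have hSD : permSubmonoid X ≤ D := hD ▸ le_sInf fun C hC => hC.2
  have hout : #(Quotient.out ((2 : Cardinal.{u}) ^ lam)) = 2 ^ lam := mk_out _
  obtain ⟨e⟩ := Cardinal.eq.1 (show #(Quotient.out ((2 : Cardinal.{u}) ^ lam)) = #(Set ι) by
    rw [hout, mk_set, hι])
  let G : Set (Quotient.out ((2 : Cardinal.{u}) ^ lam)) →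
      {M : Submonoid (Function.End X) // permSubmonoid X ≤ M ∧ M ≤ D} := fun T =>
    ⟨Submonoid.closure ((permSubmonoid X : Set (Function.End X)) ∪ F '' (e '' T)),
      fun p hp => Submonoid.subset_closure (Or.inl hp), by
        rw [Submonoid.closure_le]
        rintro _ (hp | ⟨A, -, rfl⟩)
        · exact hSD hp
        · exact hFD A⟩
  have emb : Set (Quotient.out ((2 : Cardinal.{u}) ^ lam)) ↪o
      {M : Submonoid (Function.End X) // permSubmonoid X ≤ M ∧ M ≤ D} :=
    OrderEmbedding.ofMapLEIff G fun T U => by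
      refine ⟨fun h t ht => ?_, fun h => Submonoid.closure_mono
        (Set.union_subset_union_right _ (Set.image_mono (Set.image_mono h)))⟩
      obtain ⟨v, hv, hvt⟩ := hF (e t) (e '' U)
        (h (Submonoid.subset_closure (Or.inr ⟨e t, ⟨t, ht, rfl⟩, rfl⟩)))
      exact e.injective hvt ▸ hv
  refine ⟨⟨emb⟩, le_antisymm ?_ ?_⟩
  · have hle : Cardinal.lift.{u} #(Set.Iic (#X)) ≤ Cardinal.lift.{u + 1} #ι := by
      rw [hκ, mk_Iic_aleph, ← hlam, hι, Cardinal.lift_id'.{u, u + 1}]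
    obtain ⟨κ⟩ := lift_mk_le'.1 hle
    refine (mk_submonoid_le κ κ.injective D).trans_eq ?_
    rw [mk_set, ← power_def, hι, power_self_eq hlam₀]
  · calc (2 : Cardinal.{u}) ^ ((2 : Cardinal.{u}) ^ lam)
        = #(Set (Quotient.out ((2 : Cardinal.{u}) ^ lam))) := by rw [mk_set, hout]
      _ ≤ _ := mk_le_of_injective emb.injective
end
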